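/- Let K be a field of characteristic zero with algebraic closure K̄, F ∈ K[X_1,...,X_n]^{p×q} with p ≤ q, G = (g_1,...,g_s) ⊂ K[X_1,...,X_n], and n = q-p+s+1. Then the sum of the multiplicities of the isolated points of V(I_p(F) + ⟨g_1,...,g_s⟩) is at most deg(g_1)···deg(g_s)·S_{n-s}(rdeg(F,1),...,rdeg(F,p)), where rdeg(F,i) = max_j deg(f_{i,j}) and S_k is the complete homogeneous symmetric polynomial of degree k. -/

import Mathlib

open MvPolynomial Finset

/-- Complete homogeneous symmetric polynomial of degree `k` in the values `f i`, `i ∈ s`. -/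
noncomputable def hsym {R ι : Type*} [CommSemiring R] [DecidableEq ι]
    (k : ℕ) (s : Finset ι) (f : ι → R) : R :=
  ∑ m ∈ s.sym k, ((m : Multiset ι).map f).prod

/-- `x` is an isolated point of the zero set `V(I)` (Zariski topology). -/
def IsIsolatedZero {σ K : Type*} [CommRing K] (I : Ideal (MvPolynomial σ K))
    (x : σ → K) : Prop :=
  (∀ f ∈ I, MvPolynomial.eval x f = 0) ∧
  ∃ h : MvPolynomial σ K, MvPolynomial.eval x h ≠ 0 ∧
    ∀ y : σ → K, (∀ f ∈ I, MvPolynomial.eval y f = 0) → MvPolynomial.eval y h ≠ 0 → y = x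

/-- Multiplicity of `pt` with respect to `I`: the dimension of the formal power
series quotient after translating `pt` to the origin. -/
noncomputable def multAt {σ K : Type*} [Field K]
    (I : Ideal (MvPolynomial σ K)) (pt : σ → K) : ℕ :=
  Module.finrank K (MvPowerSeries σ K ⧸
    Ideal.map ((MvPolynomial.coeToMvPowerSeries.ringHom).comp
      ((MvPolynomial.aeval
        (fun v => MvPolynomial.X v + MvPolynomial.C (pt v)) :
          MvPolynomial σ K →ₐ[K] MvPolynomial σ K)).toRingHom) I)

/-- The determinantal ideal `I_p(F) + ⟨g₁,…,g_s⟩` extended to the algebraic closure. -/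
noncomputable def detIdeal {K : Type*} [Field K] {p q s n : ℕ}
    (F : Matrix (Fin p) (Fin q) (MvPolynomial (Fin n) K))
    (g : Fin s → MvPolynomial (Fin n) K) :
    Ideal (MvPolynomial (Fin n) (AlgebraicClosure K)) :=
  Ideal.span {d : MvPolynomial (Fin n) (AlgebraicClosure K) |
      ∃ c : Fin p ↪ Fin q,
        d = ((F.map (MvPolynomial.map (algebraMap K (AlgebraicClosure K)))).submatrix id c).det}
    ⊔ Ideal.span (Set.range fun i => MvPolynomial.map (algebraMap K (AlgebraicClosure K)) (g i))

namespace DetBezout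

section Koszul
variable {B M M' : Type*} [CommRing B] [AddCommGroup M] [Module B M]
  [AddCommGroup M'] [Module B M']

/-- The differential of the Koszul complex of a list `ys` on `M`. A chain is a function on
`List Bool`; the summand indexed by a subset of `ys` is stored at its indicator list. -/
def koszulD : List B → (List Bool → M) → List Bool → M
  | [], _, _ => 0
  | _ :: _, _, [] => 0
  | y :: ys, c, false :: s => koszulD ys (fun s => c (false :: s)) s + y • c (true :: s)
  | _ :: ys, c, true :: s => -koszulD ys (fun s => c (true :: s)) s

/-- `c` is a chain of degree `i` in the Koszul complex of `ys`. -/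
def IsKoszulDeg (ys : List B) (i : ℤ) (c : List Bool → M) : Prop :=
  ∀ s, ¬ (s.length = ys.length ∧ (s.count true : ℤ) = i) → c s = 0

/-- The contracting operator attached to the `k`-th entry of the list. -/
def koszulH : ℕ → (List Bool → M) → List Bool → M
  | _, _, [] => 0
  | 0, _, false :: _ => 0
  | 0, c, true :: s => c (false :: s)
  | k + 1, c, false :: s => koszulH k (fun s => c (false :: s)) s
  | k + 1, c, true :: s => -koszulH k (fun s => c (true :: s)) s

lemma koszulD_add (ys : List B) (c d : List Bool → M) :
    koszulD ys (fun s => c s + d s) = fun s => koszulD ys c s + koszulD ys d s := by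
  induction ys generalizing c d with
  | nil => funext s; simp [koszulD]
  | cons y ys ih =>
    funext s
    match s with
    | [] => simp [koszulD]
    | false :: s => simp only [koszulD, ih, smul_add]; abel
    | true :: s => simp only [koszulD, ih]; abel

lemma koszulD_comp (ys : List B) (f : M →ₗ[B] M') (c : List Bool → M) :
    koszulD ys (fun s => f (c s)) = fun s => f (koszulD ys c s) := by
  induction ys generalizing c with
  | nil => funext s; simp [koszulD]
  | cons y ys ih =>
    funext s
    match s with
    | [] => simp [koszulD]
    | false :: s => simp only [koszulD, ih, map_add, map_smul]
    | true :: s => simp only [koszulD, ih, map_neg]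

lemma koszulD_smul (ys : List B) (b : B) (c : List Bool → M) :
    koszulD ys (fun s => b • c s) = fun s => b • koszulD ys c s :=
  koszulD_comp ys (LinearMap.lsmul B M b) c

lemma koszulD_neg (ys : List B) (c : List Bool → M) :
    koszulD ys (fun s => -c s) = fun s => -koszulD ys c s :=
  koszulD_comp ys (-LinearMap.id) c

lemma koszulD_zero (ys : List B) : koszulD ys (fun _ => (0 : M)) = fun _ => 0 := by
  have := koszulD_smul ys (0 : B) (fun _ => (0 : M))
  simpa using this

lemma koszulD_koszulD (ys : List B) (c : List Bool → M) :
    koszulD ys (koszulD ys c) = fun _ => 0 := by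
  induction ys generalizing c with
  | nil => funext s; simp [koszulD]
  | cons y ys ih =>
    funext s
    match s with
    | [] => simp [koszulD]
    | false :: s =>
      simp only [koszulD, koszulD_add, ih, koszulD_smul]
      simp
    | true :: s =>
      simp only [koszulD, koszulD_neg, ih, neg_zero]

lemma koszulH_add (k : ℕ) (c d : List Bool → M) :
    koszulH k (fun s => c s + d s) = fun s => koszulH k c s + koszulH k d s := by
  induction k generalizing c d with
  | zero => funext s; match s with
    | [] => simp [koszulH]
    | false :: s => simp [koszulH]
    | true :: s => simp [koszulH]
  | succ k ih =>
    funext s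
    match s with
    | [] => simp [koszulH]
    | false :: s => simp only [koszulH, ih]
    | true :: s => simp only [koszulH, ih]; abel

lemma koszulH_comp (k : ℕ) (f : M →ₗ[B] M') (c : List Bool → M) :
    koszulH k (fun s => f (c s)) = fun s => f (koszulH k c s) := by
  induction k generalizing c with
  | zero => funext s; match s with
    | [] => simp [koszulH]
    | false :: s => simp [koszulH]
    | true :: s => simp [koszulH]
  | succ k ih =>
    funext s
    match s with
    | [] => simp [koszulH]
    | false :: s => simp only [koszulH, ih]
    | true :: s => simp only [koszulH, ih, map_neg]

lemma koszulH_smul (k : ℕ) (b : B) (c : List Bool → M) :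
    koszulH k (fun s => b • c s) = fun s => b • koszulH k c s :=
  koszulH_comp k (LinearMap.lsmul B M b) c

lemma koszulH_neg [Module ℤ M] (k : ℕ) (c : List Bool → M) :
    koszulH k (fun s => -c s) = fun s => -koszulH k c s :=
  koszulH_comp (B := ℤ) k (-LinearMap.id) c

lemma IsKoszulDeg.false {y : B} {ys : List B} {i : ℤ} {c : List Bool → M}
    (h : IsKoszulDeg (y :: ys) i c) : IsKoszulDeg ys i (fun s => c (false :: s)) := by
  intro s hs
  apply h
  simpa using hs

lemma IsKoszulDeg.true {y : B} {ys : List B} {i : ℤ} {c : List Bool → M}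
    (h : IsKoszulDeg (y :: ys) i c) : IsKoszulDeg ys (i - 1) (fun s => c (true :: s)) := by
  intro s hs
  apply h
  simp only [List.length_cons, List.count_cons_self, Nat.cast_add, Nat.cast_one] at *
  omega

lemma IsKoszulDeg.cons {y : B} {ys : List B} {i : ℤ} {c : List Bool → M}
    (h0 : c [] = 0) (h1 : IsKoszulDeg ys i (fun s => c (Bool.false :: s)))
    (h2 : IsKoszulDeg ys (i - 1) (fun s => c (Bool.true :: s))) :
    IsKoszulDeg (y :: ys) i c := by
  intro s hs
  match s with
  | [] => exact h0
  | .false :: s => exact h1 s (by simpa using hs)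
  | .true :: s =>
    refine h2 s ?_
    simp only [List.length_cons, List.count_cons_self, Nat.cast_add, Nat.cast_one] at *
    omega

lemma IsKoszulDeg.add {ys : List B} {i : ℤ} {c d : List Bool → M}
    (hc : IsKoszulDeg ys i c) (hd : IsKoszulDeg ys i d) :
    IsKoszulDeg ys i (fun s => c s + d s) := by
  intro s hs; simp [hc s hs, hd s hs]

lemma IsKoszulDeg.comp {ys : List B} {i : ℤ} {c : List Bool → M}
    (hc : IsKoszulDeg ys i c) (f : M →ₗ[B] M') : IsKoszulDeg ys i (fun s => f (c s)) := by
  intro s hs; simp [hc s hs]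

lemma IsKoszulDeg.smul {ys : List B} {i : ℤ} {c : List Bool → M}
    (hc : IsKoszulDeg ys i c) (b : B) : IsKoszulDeg ys i (fun s => b • c s) :=
  hc.comp (LinearMap.lsmul B M b)

lemma IsKoszulDeg.neg {ys : List B} {i : ℤ} {c : List Bool → M}
    (hc : IsKoszulDeg ys i c) : IsKoszulDeg ys i (fun s => -c s) :=
  hc.comp (-LinearMap.id)

lemma IsKoszulDeg.koszulD {ys : List B} {i : ℤ} {c : List Bool → M}
    (hc : IsKoszulDeg ys i c) : IsKoszulDeg ys (i - 1) (koszulD ys c) := by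
  induction ys generalizing i c with
  | nil => intro s _; simp [DetBezout.koszulD]
  | cons y ys ih =>
    refine IsKoszulDeg.cons (by simp [DetBezout.koszulD]) ?_ ?_
    · simp only [DetBezout.koszulD]
      exact (ih hc.false).add (hc.true.smul y)
    · simp only [DetBezout.koszulD]
      exact (ih hc.true).neg

lemma IsKoszulDeg.koszulH {ys : List B} {i : ℤ} {c : List Bool → M} {k : ℕ}
    (hk : k < ys.length) (hc : IsKoszulDeg ys i c) :
    IsKoszulDeg ys (i + 1) (koszulH k c) := by
  induction ys generalizing i c k with
  | nil => simp at hk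
  | cons y ys ih =>
    refine IsKoszulDeg.cons (by simp [DetBezout.koszulH]) ?_ ?_
    · cases k with
      | zero => intro s _; simp [DetBezout.koszulH]
      | succ k =>
        simp only [DetBezout.koszulH]
        exact ih (by simpa using hk) hc.false
    · cases k with
      | zero => simp only [DetBezout.koszulH]; simpa using hc.false
      | succ k =>
        simp only [DetBezout.koszulH]
        have := (ih (k := k) (by simpa using hk) hc.true).neg
        simpa using this

lemma koszulD_koszulH_add {ys : List B} {i : ℤ} {c : List Bool → M} {k : ℕ}
    (hk : k < ys.length) (hc : IsKoszulDeg ys i c) (s : List Bool) :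
    koszulD ys (koszulH k c) s + koszulH k (koszulD ys c) s = ys[k] • c s := by
  induction ys generalizing i c k s with
  | nil => simp at hk
  | cons y ys ih =>
    match s with
    | [] => simp [koszulD, koszulH, hc [] (by simp)]
    | .false :: s =>
      cases k with
      | zero => simp [koszulD, koszulH, koszulD_zero]
      | succ k =>
        have := ih (k := k) (by simpa using hk) hc.false s
        simp only [koszulD, koszulH, koszulH_add, koszulH_smul, List.getElem_cons_succ, ← this,
          smul_neg]
        abel
    | .true :: s =>
      cases k with
      | zero => simp [koszulD, koszulH]
      | succ k =>
        have := ih (k := k) (by simpa using hk) hc.true s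
        simp only [koszulD, koszulH, koszulH_neg, koszulD_neg, List.getElem_cons_succ, ← this,
          neg_neg]

/-- The Koszul homology of `ys` on `M` vanishes in degrees above `j`. -/
def KoszulVanishes (ys : List B) (j : ℤ) (M : Type*) [AddCommGroup M] [Module B M] : Prop :=
  ∀ i, j < i → ∀ c : List Bool → M, IsKoszulDeg ys i c → koszulD ys c = (fun _ => 0) →
    ∃ e : List Bool → M, IsKoszulDeg ys (i + 1) e ∧ koszulD ys e = c

lemma koszulVanishes_length (ys : List B) : KoszulVanishes ys ys.length M := by
  intro i hi c hc _
  refine ⟨fun _ => 0, fun _ _ => rfl, ?_⟩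
  rw [koszulD_zero]
  funext s
  refine (hc s ?_).symm
  rintro ⟨h1, h2⟩
  have := List.count_le_length (a := true) (l := s)
  omega

/-- Elements of the ideal generated by `ys` annihilate the Koszul homology. -/
lemma exists_koszulD_eq_smul {ys : List B} {i : ℤ} {c : List Bool → M}
    (hc : IsKoszulDeg ys i c) (hd : koszulD ys c = fun _ => 0) {a : B}
    (ha : a ∈ Ideal.ofList ys) :
    ∃ e : List Bool → M, IsKoszulDeg ys (i + 1) e ∧ koszulD ys e = fun s => a • c s := by
  rw [Ideal.ofList] at ha
  induction ha using Submodule.span_induction with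
  | mem x hx =>
    obtain ⟨k, hk, rfl⟩ := List.getElem_of_mem hx
    refine ⟨koszulH k c, hc.koszulH hk, ?_⟩
    funext s
    have := koszulD_koszulH_add hk hc s
    have h0 : koszulH k (fun _ => (0 : M)) = fun _ => 0 := by
      simpa using koszulH_smul k (0 : B) (fun _ => (0 : M))
    rw [hd, h0] at this
    simpa using this
  | zero => exact ⟨fun _ => 0, fun _ _ => rfl, by simp [koszulD_zero]⟩
  | add x y _ _ hx hy =>
    obtain ⟨e, he, he'⟩ := hx
    obtain ⟨f, hf, hf'⟩ := hy
    exact ⟨_, he.add hf, by rw [koszulD_add, he', hf']; simp [add_smul]⟩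
  | smul b x _ hx =>
    obtain ⟨e, he, he'⟩ := hx
    exact ⟨_, he.smul b, by rw [koszulD_smul, he']; simp [mul_smul]⟩

lemma exists_lift_isKoszulDeg {ys : List B} {i : ℤ} {f : M →ₗ[B] M'}
    (hf : Function.Surjective f) {c : List Bool → M'} (hc : IsKoszulDeg ys i c) :
    ∃ d : List Bool → M, IsKoszulDeg ys i d ∧ ∀ s, f (d s) = c s := by
  classical
  choose g hg using hf
  refine ⟨fun s => if c s = 0 then 0 else g (c s), fun s hs => by simp [hc s hs], fun s => ?_⟩
  by_cases h : c s = 0 <;> simp [h, hg]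

/-- Vanishing of Koszul homology is stable under extensions. -/
lemma KoszulVanishes.of_exact {M₁ M₂ M₃ : Type*} [AddCommGroup M₁] [AddCommGroup M₂]
    [AddCommGroup M₃] [Module B M₁] [Module B M₂] [Module B M₃] {ys : List B} {j : ℤ}
    (f : M₁ →ₗ[B] M₂) (g : M₂ →ₗ[B] M₃) (hf : Function.Injective f) (hfg : Function.Exact f g)
    (hg : Function.Surjective g) (h₁ : KoszulVanishes ys j M₁) (h₃ : KoszulVanishes ys j M₃) :
    KoszulVanishes ys j M₂ := by
  intro i hi c hc hd
  obtain ⟨e, he, hde⟩ := h₃ i hi (fun s => g (c s)) (hc.comp g) (by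
    rw [koszulD_comp, hd]; simp)
  obtain ⟨e', he', hee⟩ := exists_lift_isKoszulDeg hg he
  have key : ∀ s, ∃ d, f d = c s - koszulD ys e' s := by
    intro s
    refine (hfg _).1 ?_
    have h1 := congrFun (koszulD_comp ys g e') s
    simp only [hee] at h1
    rw [map_sub, ← h1, congrFun hde s, sub_self]
  choose d hd' using key
  have hdd : IsKoszulDeg ys i d := by
    intro s hs
    apply hf
    have h1 := he'.koszulD s (by simpa using hs)
    rw [hd', hc s hs, h1, sub_self, map_zero]
  obtain ⟨u, hu, hu'⟩ := h₁ i hi d hdd (by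
    funext s
    apply hf
    have h1 := congrFun (koszulD_comp ys f d) s
    rw [← h1]
    simp only [hd', sub_eq_add_neg, koszulD_add, koszulD_neg, koszulD_koszulD, hd]
    simp)
  refine ⟨fun s => e' s + f (u s), he'.add (hu.comp f), ?_⟩
  funext s
  rw [koszulD_add, koszulD_comp, hu']
  simp [hd']

/-- If `a` is regular on `M` and lies in the ideal of `ys`, then vanishing for `M / a M`
improves by one degree on `M`. -/
lemma KoszulVanishes.of_quotient {ys : List B} {j : ℤ} {a : B} (ha : a ∈ Ideal.ofList ys)
    (hreg : IsSMulRegular M a) (h : KoszulVanishes ys (j + 1) (QuotSMulTop a M)) :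
    KoszulVanishes ys j M := by
  intro i hi c hc hd
  obtain ⟨e, he, hde⟩ := exists_koszulD_eq_smul hc hd ha
  let π : M →ₗ[B] QuotSMulTop a M := Submodule.mkQ _
  have hπ : ∀ x, π (a • x) = 0 := fun x =>
    (Submodule.Quotient.mk_eq_zero _).2 (Submodule.smul_mem_pointwise_smul _ _ _ trivial)
  obtain ⟨f, hf, hdf⟩ := h (i + 1) (by omega) (fun s => π (e s)) (he.comp π) (by
    rw [koszulD_comp, hde]; simp [hπ])
  obtain ⟨f', hf', hff⟩ := exists_lift_isKoszulDeg (Submodule.mkQ_surjective _) hf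
  have key : ∀ s, ∃ x, a • x = e s - koszulD ys f' s := by
    intro s
    have h1 : π (e s - koszulD ys f' s) = 0 := by
      have h1 := congrFun (koszulD_comp ys π f') s
      have hff' : (fun s => π (f' s)) = f := funext hff
      rw [hff'] at h1
      rw [map_sub, ← h1, congrFun hdf s, sub_self]
    obtain ⟨x, -, hx⟩ := (Submodule.mem_smul_pointwise_iff_exists _ _ _).1
      ((Submodule.Quotient.mk_eq_zero _).1 h1)
    exact ⟨x, hx⟩
  choose d hd' using key
  refine ⟨d, ?_, ?_⟩
  · intro s hs
    apply hreg
    have h1 := hf'.koszulD s (by simpa using hs)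
    simp only [hd', he s hs, h1, sub_self, smul_zero]
  · funext s
    apply hreg
    have h1 := congrFun (koszulD_smul ys a d) s
    simp only [hd', sub_eq_add_neg, koszulD_add, koszulD_neg, koszulD_koszulD, hde] at h1
    simpa using h1.symm

/-- Vanishing for `M / a M` implies vanishing for `M / a ^ k M`, when `a` is regular. -/
lemma KoszulVanishes.quotSMulTop_pow {ys : List B} {j : ℤ} {a : B}
    (hreg : IsSMulRegular M a) (h : KoszulVanishes ys j (QuotSMulTop a M)) (k : ℕ) :
    KoszulVanishes ys j (QuotSMulTop (a ^ k) M) := by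
  induction k with
  | zero =>
    have : Subsingleton (QuotSMulTop (a ^ 0) M) := by
      refine Submodule.Quotient.subsingleton_iff.2 ?_
      rw [pow_zero, one_smul]
    intro i hi c hc hd
    exact ⟨fun _ => 0, fun _ _ => rfl, by funext s; exact Subsingleton.elim _ _⟩
  | succ k ih =>
    let f : QuotSMulTop (a ^ k) M →ₗ[B] QuotSMulTop (a ^ (k + 1)) M :=
      Submodule.mapQ _ _ (LinearMap.lsmul B M a) (by
        intro x hx
        obtain ⟨y, -, rfl⟩ := (Submodule.mem_smul_pointwise_iff_exists _ _ _).1 hx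
        refine (Submodule.mem_smul_pointwise_iff_exists _ _ _).2 ⟨y, trivial, ?_⟩
        simp [pow_succ', mul_smul, smul_comm a])
    let g : QuotSMulTop (a ^ (k + 1)) M →ₗ[B] QuotSMulTop a M :=
      Submodule.mapQ _ _ LinearMap.id (by
        intro x hx
        obtain ⟨y, -, rfl⟩ := (Submodule.mem_smul_pointwise_iff_exists _ _ _).1 hx
        refine (Submodule.mem_smul_pointwise_iff_exists _ _ _).2 ⟨a ^ k • y, trivial, ?_⟩
        simp [pow_succ', mul_smul])
    refine KoszulVanishes.of_exact f g ?_ ?_ ?_ ih h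
    · rw [injective_iff_map_eq_zero]
      intro x hx
      obtain ⟨x, rfl⟩ := Submodule.mkQ_surjective _ x
      have hx' : Submodule.Quotient.mk (a • x) = (0 : QuotSMulTop (a ^ (k + 1)) M) := hx
      obtain ⟨y, -, hy⟩ := (Submodule.mem_smul_pointwise_iff_exists _ _ _).1
        ((Submodule.Quotient.mk_eq_zero _).1 hx')
      refine (Submodule.Quotient.mk_eq_zero _).2
        ((Submodule.mem_smul_pointwise_iff_exists _ _ _).2 ⟨y, trivial, ?_⟩)
      apply hreg
      simp only [← hy, pow_succ', mul_smul]
    · intro x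
      obtain ⟨x, rfl⟩ := Submodule.mkQ_surjective _ x
      constructor
      · intro hx
        have hx' : Submodule.Quotient.mk x = (0 : QuotSMulTop a M) := hx
        obtain ⟨y, -, hy⟩ := (Submodule.mem_smul_pointwise_iff_exists _ _ _).1
          ((Submodule.Quotient.mk_eq_zero _).1 hx')
        exact ⟨Submodule.Quotient.mk y, by rw [← hy]; rfl⟩
      · rintro ⟨y, hy⟩
        obtain ⟨y, rfl⟩ := Submodule.mkQ_surjective _ y
        rw [← hy]
        exact (Submodule.Quotient.mk_eq_zero _).2
          ((Submodule.mem_smul_pointwise_iff_exists _ _ _).2 ⟨y, trivial, rfl⟩)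
    · intro x
      obtain ⟨x, rfl⟩ := Submodule.mkQ_surjective _ x
      exact ⟨Submodule.Quotient.mk x, rfl⟩

lemma koszulVanishes_of_isWeaklyRegular {ys rs : List B} {j : ℤ}
    (hreg : RingTheory.Sequence.IsWeaklyRegular M rs)
    (hmem : ∀ r ∈ rs, r ∈ (Ideal.ofList ys).radical) (hj : (ys.length : ℤ) ≤ j + rs.length) :
    KoszulVanishes ys j M := by
  induction rs generalizing j M with
  | nil =>
    intro i hi
    exact koszulVanishes_length ys i (by simp at hj; omega)
  | cons r rs ih =>
    rw [RingTheory.Sequence.isWeaklyRegular_cons_iff] at hreg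
    obtain ⟨k, hk⟩ := hmem r (by simp)
    refine KoszulVanishes.of_quotient hk (hreg.1.pow k) ?_
    refine KoszulVanishes.quotSMulTop_pow hreg.1 (ih hreg.2 (fun r hr => hmem r (by simp [hr])) ?_) k
    simp at hj
    omega

lemma koszulD_mem (ys : List B) (c : List Bool → M) (s : List Bool) :
    koszulD ys c s ∈ Ideal.ofList ys • (⊤ : Submodule B M) := by
  induction ys generalizing c s with
  | nil => simp [koszulD]
  | cons y ys ih =>
    have hle : Ideal.ofList ys • (⊤ : Submodule B M) ≤ Ideal.ofList (y :: ys) • ⊤ :=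
      Submodule.smul_mono_left (by rw [Ideal.ofList_cons]; exact le_sup_right)
    match s with
    | [] => simp [koszulD]
    | .false :: s =>
      refine add_mem (hle (ih _ _)) (Submodule.smul_mem_smul ?_ trivial)
      exact Ideal.subset_span (by simp)
    | .true :: s => exact neg_mem (hle (ih _ _))

/-- If a weakly regular sequence of length `|ys| + 1` lies in the radical of the ideal generated
by `y :: ys`, then `y` is regular modulo `ys`. -/
theorem mem_of_smul_mem_of_isWeaklyRegular {y : B} {ys rs : List B}
    (hreg : RingTheory.Sequence.IsWeaklyRegular M rs)
    (hmem : ∀ r ∈ rs, r ∈ (Ideal.ofList (y :: ys)).radical) (hlen : rs.length = ys.length + 1)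
    {x : M} (hx : y • x ∈ Ideal.ofList ys • (⊤ : Submodule B M)) :
    x ∈ Ideal.ofList ys • (⊤ : Submodule B M) := by
  classical
  have hv : KoszulVanishes (y :: ys) 0 M :=
    koszulVanishes_of_isWeaklyRegular hreg hmem (by simp [hlen])
  let u : List Bool := List.replicate ys.length false
  let δ : M → List Bool → M := fun w s => if s = u then w else 0
  have hδ : ∀ w, IsKoszulDeg ys 0 (δ w) := by
    intro w s hs
    refine if_neg ?_
    rintro rfl
    simp [u, List.count_replicate] at hs
  have hδd : ∀ w, koszulD ys (δ w) = fun _ => 0 := by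
    intro w
    funext s
    refine (hδ w).koszulD s ?_
    rintro ⟨-, h⟩
    omega
  have key : ∀ w ∈ Ideal.ofList ys • (⊤ : Submodule B M),
      ∃ e, IsKoszulDeg ys 1 e ∧ koszulD ys e = δ w := by
    intro w hw
    induction hw using Submodule.smul_induction_on' with
    | smul a ha n _ =>
      obtain ⟨e, he, he'⟩ := exists_koszulD_eq_smul (hδ n) (hδd n) ha
      refine ⟨e, by simpa using he, ?_⟩
      rw [he']
      funext s
      simp only [δ]
      split_ifs <;> simp
    | add v _ w _ hv hw =>
      obtain ⟨e, he, he'⟩ := hv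
      obtain ⟨f, hf, hf'⟩ := hw
      refine ⟨_, he.add hf, ?_⟩
      rw [koszulD_add, he', hf']
      funext s
      simp only [δ]
      split_ifs <;> simp
  obtain ⟨e, he, he'⟩ := key _ hx
  let c : List Bool → M := fun s => match s with
    | [] => 0
    | .false :: s => e s
    | .true :: s => -δ x s
  have hc : IsKoszulDeg (y :: ys) 1 c :=
    IsKoszulDeg.cons rfl he (by simpa using (hδ x).neg)
  obtain ⟨f, -, hf⟩ := hv 1 one_pos c hc (by
    funext s
    match s with
    | [] => rfl
    | .false :: s =>
      change koszulD ys e s + y • (-δ x s) = 0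
      rw [he']
      simp only [δ]
      split_ifs <;> simp
    | .true :: s =>
      change -koszulD ys (fun s => -δ x s) s = 0
      rw [koszulD_neg, hδd]
      simp)
  have h1 := congrFun hf (true :: u)
  change -koszulD ys (fun s => f (true :: s)) u = -δ x u at h1
  rw [neg_inj] at h1
  have h2 := koszulD_mem ys (fun s => f (true :: s)) u
  rw [h1] at h2
  simpa [δ] using h2

end Koszul

section Star
variable {R ι : Type*} [CommRing R] [DecidableEq ι]

/-- The module of binomial relations between the products `∏ j ∈ c, ℓ j`, `c ⊆ U`, `#c = p`. -/
def starRel (ℓ : ι → R) (M : Type*) [AddCommGroup M] [Module R M] (U : Finset ι) (p : ℕ) :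
    Submodule R (Finset ι → M) :=
  Submodule.span R {v | ∃ b ⊆ U, #b = p + 1 ∧ ∃ j ∈ b, ∃ j' ∈ b, ∃ x : M,
    v = Pi.single (b.erase j) (ℓ j • x) - Pi.single (b.erase j') (ℓ j' • x)}

/-- The map `(a c) ↦ ∑ c, (∏ j ∈ c, ℓ j) • a c` on the `p`-subsets of `U`. -/
def starMap (ℓ : ι → R) (M : Type*) [AddCommGroup M] [Module R M] (U : Finset ι) (p : ℕ) :
    (Finset ι → M) →ₗ[R] M :=
  ∑ c ∈ U.powersetCard p, (∏ j ∈ c, ℓ j) • LinearMap.proj c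

variable {ℓ : ι → R} {M : Type*} [AddCommGroup M] [Module R M] {U : Finset ι} {p : ℕ}

lemma starMap_apply (a : Finset ι → M) :
    starMap ℓ M U p a = ∑ c ∈ U.powersetCard p, (∏ j ∈ c, ℓ j) • a c := by
  simp [starMap]

lemma starMap_single {c : Finset ι} (hc : c ∈ U.powersetCard p) (x : M) :
    starMap ℓ M U p (Pi.single c x) = (∏ j ∈ c, ℓ j) • x := by
  rw [starMap_apply, Finset.sum_eq_single c]
  · simp
  · intro d _ hd
    simp [hd]
  · exact fun h => (h hc).elim

lemma starRel_le_ker : starRel ℓ M U p ≤ LinearMap.ker (starMap ℓ M U p) := by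
  refine Submodule.span_le.2 ?_
  rintro _ ⟨b, hb, hbc, j, hj, j', hj', x, rfl⟩
  have h1 : ∀ j ∈ b, b.erase j ∈ U.powersetCard p := fun j hj =>
    mem_powersetCard.2 ⟨(erase_subset _ _).trans hb, by rw [card_erase_of_mem hj, hbc]; rfl⟩
  simp only [SetLike.mem_coe, LinearMap.mem_ker, map_sub, starMap_single (h1 j hj),
    starMap_single (h1 j' hj'), smul_smul, Finset.prod_erase_mul _ _ hj,
    Finset.prod_erase_mul _ _ hj', sub_self]

lemma starRel_mono {U' : Finset ι} (h : U ⊆ U') : starRel ℓ M U p ≤ starRel ℓ M U' p :=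
  Submodule.span_mono (by
    rintro _ ⟨b, hb, hbc, j, hj, j', hj', x, rfl⟩
    exact ⟨b, hb.trans h, hbc, j, hj, j', hj', x, rfl⟩)

lemma exists_starRel_lift {M' : Type*} [AddCommGroup M'] [Module R M'] (π : M →ₗ[R] M')
    (hπ : Function.Surjective π) {r : Finset ι → M'} (hr : r ∈ starRel ℓ M' U p) :
    ∃ r' ∈ starRel ℓ M U p, ∀ c, π (r' c) = r c := by
  induction hr using Submodule.span_induction with
  | mem v hv =>
    obtain ⟨b, hb, hbc, j, hj, j', hj', x, rfl⟩ := hv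
    obtain ⟨x, rfl⟩ := hπ x
    refine ⟨_, Submodule.subset_span ⟨b, hb, hbc, j, hj, j', hj', x, rfl⟩, fun c => ?_⟩
    simp only [Pi.sub_apply, map_sub, ← map_smul]
    congr 1 <;> exact Pi.apply_single (fun _ => π) (fun _ => map_zero _) _ _ _
  | zero => exact ⟨0, zero_mem _, by simp⟩
  | add v w _ _ hv hw =>
    obtain ⟨v', hv, hv'⟩ := hv
    obtain ⟨w', hw, hw'⟩ := hw
    exact ⟨v' + w', add_mem hv hw, by simp [hv', hw']⟩
  | smul a v _ hv =>
    obtain ⟨v', hv, hv'⟩ := hv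
    exact ⟨a • v', Submodule.smul_mem _ _ hv, by simp [hv']⟩

lemma starRel_support {r : Finset ι → M} (hr : r ∈ starRel ℓ M U p) (c : Finset ι)
    (hc : c ∉ U.powersetCard p) : r c = 0 := by
  induction hr using Submodule.span_induction with
  | mem v hv =>
    obtain ⟨b, hb, hbc, j, hj, j', hj', x, rfl⟩ := hv
    have h1 : ∀ j ∈ b, c ≠ b.erase j := by
      rintro j hj rfl
      exact hc (mem_powersetCard.2 ⟨(erase_subset _ _).trans hb,
        by rw [card_erase_of_mem hj, hbc]; rfl⟩)
    simp [h1 j hj, h1 j' hj']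
  | zero => rfl
  | add v w _ _ hv hw => simp [hv, hw]
  | smul a v _ hv => simp [hv]

/-- Pushing a family indexed by `p`-subsets forward along `c ↦ insert j₀ c`. -/
def starShift (j₀ : ι) : (Finset ι → M) →ₗ[R] (Finset ι → M) where
  toFun v c := if j₀ ∈ c then v (c.erase j₀) else 0
  map_add' v w := by funext c; by_cases h : j₀ ∈ c <;> simp [h]
  map_smul' v w := by funext c; by_cases h : j₀ ∈ c <;> simp [h]

lemma starShift_single {j₀ : ι} {c : Finset ι} (hc : j₀ ∉ c) (x : M) :
    starShift (R := R) j₀ (Pi.single c x) = Pi.single (insert j₀ c) x := by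
  funext d
  simp only [starShift, LinearMap.coe_mk, AddHom.coe_mk, Pi.single_apply]
  by_cases hd : j₀ ∈ d
  · rw [if_pos hd]
    congr 1
    rw [eq_iff_iff]
    constructor
    · rintro rfl; rw [insert_erase hd]
    · rintro rfl; rw [erase_insert hc]
  · rw [if_neg hd, if_neg]
    rintro rfl
    exact hd (mem_insert_self _ _)

lemma starShift_mem {j₀ : ι} (hj₀ : j₀ ∉ U) {v : Finset ι → M} (hv : v ∈ starRel ℓ M U p) :
    starShift (R := R) j₀ v ∈ starRel ℓ M (insert j₀ U) (p + 1) := by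
  induction hv using Submodule.span_induction with
  | mem v hv =>
    obtain ⟨b, hb, hbc, j, hj, j', hj', x, rfl⟩ := hv
    have h0 : j₀ ∉ b := fun h => hj₀ (hb h)
    have h1 : ∀ j ∈ b, ∀ x : M, starShift (R := R) j₀ (Pi.single (b.erase j) x)
        = Pi.single ((insert j₀ b).erase j) x := by
      intro j hj x
      rw [starShift_single (fun h => h0 (mem_of_mem_erase h)), erase_insert_of_ne]
      rintro rfl; exact h0 hj
    rw [map_sub, h1 j hj, h1 j' hj']
    exact Submodule.subset_span ⟨insert j₀ b, insert_subset_insert _ hb,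
      by rw [card_insert_of_notMem h0, hbc], j, mem_insert_of_mem hj, j',
      mem_insert_of_mem hj', x, rfl⟩
  | zero => simp
  | add v w _ _ hv hw => simpa using add_mem hv hw
  | smul a v _ hv => simpa using Submodule.smul_mem _ a hv

lemma single_smul_sub_mem {j₀ j : ι} {c : Finset ι} (hc : c ⊆ U) (hcp : #c = p)
    (hj₀ : j₀ ∉ c) (hj : j ∈ c) (x : M) :
    Pi.single c (ℓ j₀ • x) - Pi.single ((insert j₀ c).erase j) (ℓ j • x) ∈
      starRel ℓ M (insert j₀ U) p := by
  refine Submodule.subset_span ⟨insert j₀ c, insert_subset_insert _ hc,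
    by rw [card_insert_of_notMem hj₀, hcp], j₀, mem_insert_self _ _, j, mem_insert_of_mem hj, x, ?_⟩
  rw [erase_insert hj₀]

lemma starMap_insert {j₀ : ι} (hj₀ : j₀ ∉ U) (a : Finset ι → M) :
    starMap ℓ M (insert j₀ U) (p + 1) a =
      starMap ℓ M U (p + 1) a + ℓ j₀ • starMap ℓ M U p (fun c => a (insert j₀ c)) := by
  have hd : Disjoint (powersetCard (p + 1) U) ((powersetCard p U).image (insert j₀)) := by
    rw [disjoint_left]
    intro c hc hc'
    obtain ⟨d, -, rfl⟩ := mem_image.1 hc'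
    exact hj₀ ((mem_powersetCard.1 hc).1 (mem_insert_self _ _))
  have hn : ∀ c ∈ powersetCard p U, j₀ ∉ c := fun c hc h => hj₀ ((mem_powersetCard.1 hc).1 h)
  rw [starMap_apply, starMap_apply, starMap_apply, powersetCard_succ_insert hj₀,
    sum_union hd, sum_image, smul_sum]
  · congr 1
    refine sum_congr rfl fun c hc => ?_
    rw [prod_insert (hn c hc), mul_smul]
  · intro c hc d hd h
    have := congrArg (fun s => Finset.erase s j₀) h
    simpa [erase_insert (hn c hc), erase_insert (hn d hd)] using this

/-- The relations between the products of `p` of the `m + p - 1` elements `ℓ j` are generated by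
binomial ones, if any `m` of the elements form a regular sequence. -/
theorem mem_starRel_of_starMap_eq_zero (U : Finset ι) (m p : ℕ) (hU : #U + 1 = m + p)
    (hreg : ∀ L : List ι, L.Nodup → (∀ j ∈ L, j ∈ U) → L.length ≤ m →
      RingTheory.Sequence.IsWeaklyRegular M (L.map ℓ))
    (a : Finset ι → M) (hsupp : ∀ c ∉ U.powersetCard p, a c = 0)
    (ha : starMap ℓ M U p a = 0) : a ∈ starRel ℓ M U p := by
  induction U using Finset.induction_on generalizing m p M with
  | empty =>
    suffices a = 0 by rw [this]; exact zero_mem _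
    funext c
    by_cases hc : c ∈ powersetCard p (∅ : Finset ι)
    · have hc' := mem_powersetCard.1 hc
      obtain rfl : c = ∅ := subset_empty.1 hc'.1
      obtain rfl : p = 0 := by simpa using hc'.2.symm
      simpa [starMap_apply] using ha
    · exact hsupp c hc
  | insert j₀ U hj₀ ih =>
    rw [card_insert_of_notMem hj₀] at hU
    rcases m with _ | m
    · suffices a = 0 by rw [this]; exact zero_mem _
      funext c
      refine hsupp c fun hc => ?_
      have h := mem_powersetCard.1 hc
      have := card_le_card h.1
      rw [card_insert_of_notMem hj₀] at this
      omega
    rcases p with _ | p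
    · suffices a = 0 by rw [this]; exact zero_mem _
      funext c
      by_cases hc : c = ∅
      · subst hc
        simpa [starMap_apply] using ha
      · exact hsupp c (by simpa using hc)
    have hr₀ : IsSMulRegular M (ℓ j₀) := by
      have := hreg [j₀] (by simp) (by simp) (by simp)
      simpa using this
    -- reduce modulo `ℓ j₀`
    let π : M →ₗ[R] QuotSMulTop (ℓ j₀) M := Submodule.mkQ _
    have hπ : Function.Surjective π := Submodule.mkQ_surjective _
    have hreg' : ∀ L : List ι, L.Nodup → (∀ j ∈ L, j ∈ U) → L.length ≤ m →
        RingTheory.Sequence.IsWeaklyRegular (QuotSMulTop (ℓ j₀) M) (L.map ℓ) := by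
      intro L hL hLU hLm
      have := hreg (j₀ :: L) (List.nodup_cons.2 ⟨fun h => hj₀ (hLU _ h), hL⟩)
        (by simpa using fun j hj => Or.inr (hLU j hj)) (by simpa using hLm)
      rw [List.map_cons, RingTheory.Sequence.isWeaklyRegular_cons_iff] at this
      exact this.2
    have hπ₀ : ∀ x, π (ℓ j₀ • x) = 0 := fun x =>
      (Submodule.Quotient.mk_eq_zero _).2
        ((Submodule.mem_smul_pointwise_iff_exists _ _ _).2 ⟨x, trivial, rfl⟩)
    have hbar : starMap ℓ (QuotSMulTop (ℓ j₀) M) U (p + 1)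
        (fun c => if c ∈ U.powersetCard (p + 1) then π (a c) else 0) = 0 := by
      have h1 := congrArg π ha
      rw [starMap_insert hj₀, map_add, hπ₀, add_zero, map_zero, starMap_apply, map_sum] at h1
      rw [starMap_apply, ← h1]
      refine sum_congr rfl fun c hc => ?_
      rw [if_pos hc, map_smul]
    obtain ⟨r, hr, hr'⟩ := exists_starRel_lift π hπ
      (ih m (p + 1) (by omega) hreg' _ (fun c hc => if_neg hc) hbar)
    -- the difference is divisible by `ℓ j₀` on subsets of `U`
    have hdiff : ∀ c, ∃ x, c ∈ U.powersetCard (p + 1) → ℓ j₀ • x = a c - r c := by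
      intro c
      by_cases hc : c ∈ U.powersetCard (p + 1)
      · have h1 : π (a c - r c) = 0 := by rw [map_sub, hr' c, if_pos hc, sub_self]
        obtain ⟨x, -, hx⟩ := (Submodule.mem_smul_pointwise_iff_exists _ _ _).1
          ((Submodule.Quotient.mk_eq_zero _).1 h1)
        exact ⟨x, fun _ => hx⟩
      · exact ⟨0, fun h => (hc h).elim⟩
    choose d hd using hdiff
    have hne : ∀ c ∈ U.powersetCard (p + 1), ∃ j, j ∈ c := by
      intro c hc
      have := (mem_powersetCard.1 hc).2
      exact card_pos.1 (by omega)
    have : Nonempty ι := ⟨j₀⟩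
    choose! jj hjj using hne
    let e : Finset ι → M := ∑ c ∈ U.powersetCard (p + 1),
      (Pi.single c (ℓ j₀ • d c) - Pi.single ((insert j₀ c).erase (jj c)) (ℓ (jj c) • d c))
    have he : e ∈ starRel ℓ M (insert j₀ U) (p + 1) := by
      refine sum_mem fun c hc => ?_
      have h := mem_powersetCard.1 hc
      exact single_smul_sub_mem h.1 h.2 (fun h' => hj₀ (h.1 h')) (hjj c hc) _
    have hr1 : r ∈ starRel ℓ M (insert j₀ U) (p + 1) := starRel_mono (subset_insert _ _) hr
    set a' : Finset ι → M := a - r - e with ha'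
    have ha'0 : starMap ℓ M (insert j₀ U) (p + 1) a' = 0 := by
      rw [ha', map_sub, map_sub, ha, LinearMap.mem_ker.1 (starRel_le_ker hr1),
        LinearMap.mem_ker.1 (starRel_le_ker he)]
      simp
    have heU : ∀ c ∈ U.powersetCard (p + 1), e c = ℓ j₀ • d c := by
      intro c hc
      have hj : j₀ ∉ c := fun h => hj₀ ((mem_powersetCard.1 hc).1 h)
      have h2 : ∀ c' ∈ U.powersetCard (p + 1), c ≠ (insert j₀ c').erase (jj c') := by
        rintro c' hc' rfl
        refine hj (mem_erase.2 ⟨?_, mem_insert_self _ _⟩)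
        intro h
        exact hj₀ ((mem_powersetCard.1 hc').1 (h ▸ hjj c' hc'))
      simp only [e, Finset.sum_apply, Pi.sub_apply]
      rw [sum_eq_single c]
      · simp [h2 c hc]
      · intro c' hc' hcc
        simp [h2 c' hc', hcc.symm]
      · exact fun h => (h hc).elim
    have ha'U : ∀ c ∈ U.powersetCard (p + 1), a' c = 0 := by
      intro c hc
      rw [ha', Pi.sub_apply, Pi.sub_apply, heU c hc, hd c hc, sub_self]
    have ha's : ∀ c ∉ (insert j₀ U).powersetCard (p + 1), a' c = 0 := by
      intro c hc
      rw [ha', Pi.sub_apply, Pi.sub_apply, hsupp c hc, starRel_support hr1 c hc,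
        starRel_support he c hc]
      simp
    let a'' : Finset ι → M := fun c => if j₀ ∈ c then 0 else a' (insert j₀ c)
    have ha''0 : starMap ℓ M U p a'' = 0 := by
      apply hr₀
      change ℓ j₀ • starMap ℓ M U p a'' = ℓ j₀ • (0 : M)
      rw [smul_zero, ← ha'0, starMap_insert hj₀]
      have h1 : starMap ℓ M U (p + 1) a' = 0 := by
        rw [starMap_apply]
        exact sum_eq_zero fun c hc => by rw [ha'U c hc, smul_zero]
      have h2 : starMap ℓ M U p a'' = starMap ℓ M U p fun c => a' (insert j₀ c) := by
        rw [starMap_apply, starMap_apply]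
        refine sum_congr rfl fun c hc => ?_
        have hj : j₀ ∉ c := fun h => hj₀ ((mem_powersetCard.1 hc).1 h)
        simp only [a'', if_neg hj]
      rw [h1, h2, zero_add]
    have hmem := ih (m + 1) p (by omega)
      (fun L hL hLU hLm => hreg L hL (fun j hj => mem_insert_of_mem (hLU j hj)) hLm) a''
      (by
        intro c hc
        by_cases hj : j₀ ∈ c
        · simp only [a'', if_pos hj]
        · simp only [a'', if_neg hj]
          refine ha's _ fun h => hc ?_
          have h' := mem_powersetCard.1 h
          rw [card_insert_of_notMem hj] at h'
          refine mem_powersetCard.2 ⟨?_, by omega⟩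
          intro x hx
          exact ((mem_insert.1 (h'.1 (mem_insert_of_mem hx))).resolve_left
            (by rintro rfl; exact hj hx))) ha''0
    have hsh : starShift (R := R) j₀ a'' = a' := by
      funext c
      simp only [starShift, LinearMap.coe_mk, AddHom.coe_mk]
      by_cases hj : j₀ ∈ c
      · simp [a'', hj, insert_erase hj]
      · rw [if_neg hj]
        symm
        by_cases hc : c ∈ U.powersetCard (p + 1)
        · exact ha'U c hc
        · refine ha's c fun h => hc ?_
          have h' := mem_powersetCard.1 h
          exact mem_powersetCard.2 ⟨(subset_insert_iff_of_notMem hj).1 h'.1, h'.2⟩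
    have hfin := starShift_mem hj₀ hmem
    rw [hsh] at hfin
    have : a = a' + e + r := by rw [ha']; abel
    rw [this]
    exact add_mem (add_mem hfin he) hr1

end Star

section RegularForms
variable {S : Type*} [CommRing S]

lemma isWeaklyRegular_of_forall {R : Type*} [CommRing R] (rs : List R)
    (h : ∀ (i : ℕ) (hi : i < rs.length) (x : R),
      rs[i] * x ∈ Ideal.ofList (rs.take i) → x ∈ Ideal.ofList (rs.take i)) :
    RingTheory.Sequence.IsWeaklyRegular R rs := by
  refine (RingTheory.Sequence.isWeaklyRegular_iff R rs).2 fun i hi => ?_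
  rw [isSMulRegular_iff_right_eq_zero_of_smul]
  intro x hx
  obtain ⟨x, rfl⟩ := Submodule.Quotient.mk_surjective _ x
  rw [← Submodule.Quotient.mk_smul, Submodule.Quotient.mk_eq_zero] at hx
  rw [Submodule.Quotient.mk_eq_zero]
  simp only [smul_eq_mul, Ideal.mul_top] at hx ⊢
  exact h i hi x hx

lemma isWeaklyRegular_map_ringEquiv {R R' : Type*} [CommRing R] [CommRing R'] (e : R ≃+* R')
    {rs : List R} (h : RingTheory.Sequence.IsWeaklyRegular R rs) :
    RingTheory.Sequence.IsWeaklyRegular R' (rs.map e) :=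
  (AddEquiv.isWeaklyRegular_congr (e := e.toAddEquiv) (List.forall₂_map_right_iff.mpr <|
    List.forall₂_same.mpr fun r _ x => map_mul e r x)).1 h

lemma mem_ofList_map_X {σ : Type*} (L : List σ) (f : MvPolynomial σ S) :
    f ∈ Ideal.ofList (L.map (X : σ → MvPolynomial σ S)) ↔
      ∀ d, (∀ i ∈ L, d i = 0) → coeff d f = 0 := by
  have : Ideal.ofList (L.map (X : σ → MvPolynomial σ S)) = Ideal.span (X '' {i | i ∈ L}) := by
    rw [Ideal.ofList]
    congr 1
    ext x
    simp
  rw [this, mem_ideal_span_X_image]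
  constructor
  · intro h d hd
    by_contra hne
    obtain ⟨i, hi, hi'⟩ := h d (mem_support_iff.2 hne)
    exact hi' (hd i hi)
  · intro h d hd
    by_contra! hne
    exact mem_support_iff.1 hd (h d hne)

lemma mem_of_X_mul_mem {σ : Type*} {L : List σ} {i : σ} (hi : i ∉ L) {f : MvPolynomial σ S}
    (hf : X i * f ∈ Ideal.ofList (L.map (X : σ → MvPolynomial σ S))) :
    f ∈ Ideal.ofList (L.map (X : σ → MvPolynomial σ S)) := by
  classical
  rw [mem_ofList_map_X] at hf ⊢
  intro d hd
  have := hf (Finsupp.single i 1 + d) (fun j hj => by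
    have : i ≠ j := by rintro rfl; exact hi hj
    simp [hd j hj, this])
  rwa [coeff_X_mul] at this

lemma isWeaklyRegular_map_X {σ : Type*} {L : List σ} (hL : L.Nodup) :
    RingTheory.Sequence.IsWeaklyRegular (MvPolynomial σ S)
      (L.map (X : σ → MvPolynomial σ S)) := by
  refine isWeaklyRegular_of_forall _ fun i hi x hx => ?_
  rw [← List.map_take, List.getElem_map] at hx
  rw [← List.map_take]
  refine mem_of_X_mul_mem ?_ hx
  rw [List.mem_take_iff_getElem]
  rintro ⟨j, hj, hj'⟩
  have := hL.getElem_inj_iff.1 hj'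
  omega

/-- The linear change of coordinates attached to an invertible matrix. -/
noncomputable def linearChange {m : ℕ} (W : Matrix (Fin m) (Fin m) S) (hW : IsUnit W.det) :
    MvPolynomial (Fin m) S ≃ₐ[S] MvPolynomial (Fin m) S :=
  have key : ∀ A B : Matrix (Fin m) (Fin m) S, A * B = 1 →
      (aeval (fun i => ∑ r, C (B i r) * X r) : MvPolynomial (Fin m) S →ₐ[S] _).comp
        (aeval (fun i => ∑ r, C (A i r) * X r)) = AlgHom.id S (MvPolynomial (Fin m) S) := by
    intro A B hAB
    refine MvPolynomial.algHom_ext fun i => ?_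
    simp only [AlgHom.comp_apply, aeval_X, map_sum, map_mul, algHom_C, algebraMap_eq,
      AlgHom.id_apply, Finset.mul_sum, ← mul_assoc]
    rw [Finset.sum_comm]
    simp only [← C_mul]
    simp only [← Finset.sum_mul, ← map_sum, ← Matrix.mul_apply, hAB, Matrix.one_apply]
    simp
  AlgEquiv.ofAlgHom (aeval (fun i => ∑ r, C (W i r) * X r))
    (aeval (fun i => ∑ r, C (W⁻¹ i r) * X r))
    (key _ _ (Matrix.nonsing_inv_mul W hW)) (key _ _ (Matrix.mul_nonsing_inv W hW))

lemma linearChange_X {m : ℕ} (W : Matrix (Fin m) (Fin m) S) (hW : IsUnit W.det) (i : Fin m) :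
    linearChange W hW (X i) = ∑ r, C (W i r) * X r := by
  change aeval (fun i => ∑ r, C (W i r) * X r) (X i) = _
  simp

/-- The linear form with coefficients the powers of `a`. -/
noncomputable def powForm (m : ℕ) (a : S) : MvPolynomial (Fin m) S :=
  ∑ r : Fin m, C (a ^ (r : ℕ)) * X r

lemma isUnit_det_vandermonde {m : ℕ} {a : Fin m → S}
    (ha : Pairwise fun i j => IsUnit (a i - a j)) : IsUnit (Matrix.vandermonde a).det := by
  rw [Matrix.det_vandermonde]
  refine (IsUnit.prod_univ_iff).2 fun i => (IsUnit.prod_iff).2 fun j hj => ?_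
  exact ha (Finset.mem_Ioi.1 hj).ne'

lemma isWeaklyRegular_powForm {m q : ℕ} (hmq : m ≤ q) {a : Fin q → S}
    (ha : Pairwise fun i j => IsUnit (a i - a j)) {L : List (Fin q)} (hL : L.Nodup)
    (hLm : L.length ≤ m) :
    RingTheory.Sequence.IsWeaklyRegular (MvPolynomial (Fin m) S)
      (L.map fun j => powForm m (a j)) := by
  obtain ⟨L', hLL', hL', hL'm⟩ : ∃ L' : List (Fin q), L <+: L' ∧ L'.Nodup ∧ L'.length = m := by
    have hcard : L.length + #(univ \ L.toFinset) = q := by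
      rw [card_sdiff_of_subset (subset_univ _), List.toFinset_card_of_nodup hL, card_fin]
      have := hL.length_le_card
      rw [Fintype.card_fin] at this
      omega
    refine ⟨L ++ ((univ \ L.toFinset).toList.take (m - L.length)), List.prefix_append _ _, ?_, ?_⟩
    · refine List.Nodup.append hL ((List.take_sublist _ _).nodup (nodup_toList _)) ?_
      intro x hx hx'
      have := List.mem_of_mem_take hx'
      simp [hx] at this
    · rw [List.length_append, List.length_take, length_toList]
      omega
  obtain ⟨L'', rfl⟩ := hLL'
  suffices h : RingTheory.Sequence.IsWeaklyRegular (MvPolynomial (Fin m) S)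
      ((L ++ L'').map fun j => powForm m (a j)) by
    rw [List.map_append, RingTheory.Sequence.isWeaklyRegular_append_iff] at h
    exact h.1
  generalize L ++ L'' = L at hL' hL'm
  subst hL'm
  have hW : IsUnit (Matrix.vandermonde fun i : Fin L.length => a (L.get i)).det :=
    isUnit_det_vandermonde fun i j hij => ha (fun h => hij (hL'.injective_get h))
  have := isWeaklyRegular_map_ringEquiv (linearChange _ hW).toRingEquiv
    (isWeaklyRegular_map_X (S := S) (List.nodup_finRange L.length))
  have heq : L.map (fun j => powForm L.length (a j)) =
      ((List.finRange L.length).map X).map (linearChange _ hW).toRingEquiv := by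
    refine List.ext_getElem (by simp) fun i hi hi' => ?_
    simp only [List.getElem_map, List.getElem_finRange]
    exact (linearChange_X _ hW _).symm
  rw [heq]
  exact this

end RegularForms

section Minors
variable {R : Type*} [CommRing R] {p q : ℕ}

/-- The ideal of maximal minors. -/
def minorIdeal (Z : Matrix (Fin p) (Fin q) R) : Ideal R :=
  Ideal.span {d | ∃ c : Fin p ↪ Fin q, d = (Z.submatrix id c).det}

/-- The maximal minor on a set of columns. -/
noncomputable def minorOn (Z : Matrix (Fin p) (Fin q) R) (c : Finset (Fin q)) : R :=
  if h : #c = p then (Z.submatrix id (c.orderEmbOfFin h)).det else 0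

lemma minorOn_eq (Z : Matrix (Fin p) (Fin q) R) {c : Finset (Fin q)} (h : #c = p) :
    minorOn Z c = (Z.submatrix id (c.orderEmbOfFin h)).det := dif_pos h

lemma minorIdeal_map {R' : Type*} [CommRing R'] (φ : R →+* R') (Z : Matrix (Fin p) (Fin q) R) :
    (minorIdeal Z).map φ = minorIdeal (Z.map φ) := by
  rw [minorIdeal, Ideal.map_span, minorIdeal]
  congr 1
  ext d
  simp only [Set.mem_image, Set.mem_ofPred_eq]
  constructor
  · rintro ⟨_, ⟨c, rfl⟩, rfl⟩
    exact ⟨c, by rw [RingHom.map_det]; rfl⟩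
  · rintro ⟨c, rfl⟩
    exact ⟨_, ⟨c, rfl⟩, by rw [RingHom.map_det]; rfl⟩

lemma minorIdeal_eq_span_minorOn (Z : Matrix (Fin p) (Fin q) R) :
    minorIdeal Z = Ideal.span (minorOn Z '' {c | #c = p}) := by
  apply le_antisymm
  · refine Ideal.span_le.2 ?_
    rintro _ ⟨c, rfl⟩
    have hcard : #(univ.map c) = p := by simp
    have hmem : ∀ i, c i ∈ univ.map c := fun i => mem_map_of_mem _ (mem_univ i)
    let e : Fin p → Fin p := fun i => ((univ.map c).orderIsoOfFin hcard).symm ⟨c i, hmem i⟩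
    have he : Function.Injective e := by
      intro i j hij
      simpa [e] using hij
    let σ : Equiv.Perm (Fin p) := Equiv.ofBijective e (Finite.injective_iff_bijective.1 he)
    have hc : Z.submatrix id c =
        (Z.submatrix id ((univ.map c).orderEmbOfFin hcard)).submatrix id σ := by
      ext i j
      simp [Matrix.submatrix_apply, σ, e, ← Finset.coe_orderIsoOfFin_apply]
    rw [hc, Matrix.det_permute', ← minorOn_eq Z hcard]
    exact Ideal.mul_mem_left _ _ (Ideal.subset_span ⟨_, hcard, rfl⟩)
  · refine Ideal.span_le.2 ?_
    rintro _ ⟨c, hc, rfl⟩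
    rw [minorOn_eq Z hc]
    exact Ideal.subset_span ⟨(c.orderEmbOfFin hc).toEmbedding, rfl⟩

lemma card_filter_lt_orderEmbOfFin {b : Finset (Fin q)} {l : ℕ} (hb : #b = l) (k : Fin l) :
    #{i ∈ b | i < b.orderEmbOfFin hb k} = k := by
  have : {i ∈ b | i < b.orderEmbOfFin hb k} = (Iio k).map (b.orderEmbOfFin hb).toEmbedding := by
    ext i
    simp only [mem_filter, mem_map, mem_Iio, RelEmbedding.coe_toEmbedding]
    constructor
    · rintro ⟨hi, hlt⟩
      have : i ∈ Set.range (b.orderEmbOfFin hb) := by simpa using hi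
      obtain ⟨l, rfl⟩ := this
      exact ⟨l, by simpa using hlt, rfl⟩
    · rintro ⟨l, hl, rfl⟩
      exact ⟨by simp, by simpa using hl⟩
  rw [this, card_map, Fin.card_Iio]

lemma orderEmbOfFin_erase {b : Finset (Fin q)} (hb : #b = p + 1) (k : Fin (p + 1))
    (h : #(b.erase (b.orderEmbOfFin hb k)) = p) (i : Fin p) :
    (b.erase (b.orderEmbOfFin hb k)).orderEmbOfFin h i = b.orderEmbOfFin hb (k.succAbove i) := by
  have := Finset.orderEmbOfFin_unique h (f := fun i => b.orderEmbOfFin hb (k.succAbove i))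
    (fun i => by simp [Fin.succAbove_ne])
    ((b.orderEmbOfFin hb).strictMono.comp (Fin.strictMono_succAbove k))
  exact (congrFun this i).symm

/-- The Plücker-type relation: a combination of the rows, paired with the maximal minors on
the subsets `b.erase j`, gives zero. -/
lemma sum_rowComb_mul_minorOn_erase (Z : Matrix (Fin p) (Fin q) R) (w : Fin p → R)
    {b : Finset (Fin q)} (hb : #b = p + 1) :
    ∑ j ∈ b, (-1) ^ #{i ∈ b | i < j} * (∑ i, w i * Z i j) * minorOn Z (b.erase j) = 0 := by
  let N : Matrix (Fin (p + 1)) (Fin (p + 1)) R := Matrix.of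
    (Fin.cons (fun k => ∑ i, w i * Z i (b.orderEmbOfFin hb k))
      (fun i k => Z i (b.orderEmbOfFin hb k)))
  have hN : N.det = 0 := by
    have h0 : N = (N.updateRow 0 (∑ i ∈ univ.erase (0 : Fin (p + 1)),
        (Fin.cons 0 w : Fin (p + 1) → R) i • N i)) := by
      ext i k
      refine Fin.cases ?_ (fun i => ?_) i
      · rw [Matrix.updateRow_self, Finset.sum_apply]
        have : (univ.erase (0 : Fin (p + 1))) = univ.map (Fin.succEmb p) := by
          ext i
          refine Fin.cases ?_ (fun i => ?_) i <;> simp [Fin.succ_ne_zero]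
        rw [this, sum_map]
        simp [N]
      · rw [Matrix.updateRow_ne (Fin.succ_ne_zero i)]
    rw [h0]
    have := Matrix.det_updateRow_sum_aux N (j := 0) (univ.erase 0) (by simp)
      (Fin.cons 0 w : Fin (p + 1) → R) 0
    simpa using this
  rw [Matrix.det_succ_row_zero] at hN
  rw [← hN, ← Finset.sum_coe_sort b]
  refine (Fintype.sum_equiv (b.orderIsoOfFin hb).toEquiv _ _ fun k => ?_).symm
  have hk : ((b.orderIsoOfFin hb) k : Fin q) = b.orderEmbOfFin hb k := rfl
  have hcard : #(b.erase (b.orderEmbOfFin hb k)) = p := by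
    rw [card_erase_of_mem (by simp), hb]; rfl
  simp only [RelIso.coe_fn_toEquiv, hk]
  rw [card_filter_lt_orderEmbOfFin, minorOn_eq _ hcard]
  congr 2
  ext i j
  simp [N, orderEmbOfFin_erase hb k hcard]

end Minors

section Degree
variable {σ S : Type*} [CommRing S]

/-- Polynomials all of whose monomials have degree `< d`. -/
noncomputable def degLT (σ S : Type*) [CommRing S] (d : ℕ) : Submodule S (MvPolynomial σ S) :=
  restrictSupport S {e | e.degree < d}

lemma mem_degLT {d : ℕ} {f : MvPolynomial σ S} :
    f ∈ degLT σ S d ↔ ∀ e ∈ f.support, e.degree < d := Iff.rfl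

lemma degLT_mono {d e : ℕ} (h : d ≤ e) : degLT σ S d ≤ degLT σ S e :=
  fun _ hf _ hμ => (hf hμ).trans_le h

lemma mul_mem_degLT {d e : ℕ} {f g : MvPolynomial σ S} (hf : f ∈ degLT σ S d)
    (hg : g.totalDegree ≤ e) : f * g ∈ degLT σ S (d + e) := by
  classical
  refine mem_degLT.2 fun μ hμ => ?_
  obtain ⟨a, ha, b, hb, rfl⟩ := Finset.mem_add.1 (support_mul f g hμ)
  have h1 : a.degree < d := hf ha
  have h2 : b.degree ≤ e := (le_totalDegree hb).trans hg
  change (a + b).degree < d + e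
  rw [map_add]
  omega

lemma mem_degLT_of_totalDegree_lt {d : ℕ} {f : MvPolynomial σ S} (h : f.totalDegree < d) :
    f ∈ degLT σ S d :=
  fun _ hμ => (le_totalDegree hμ).trans_lt h

lemma eq_zero_of_isHomogeneous_of_mem_degLT {d e : ℕ} (hde : d ≤ e) {f : MvPolynomial σ S}
    (hf : f.IsHomogeneous e) (hf' : f ∈ degLT σ S d) : f = 0 := by
  by_contra hne
  obtain ⟨μ, hμ⟩ := support_nonempty.2 hne
  have h1 : μ.degree < d := hf' hμ
  have h2 : μ.degree = e := by
    rw [Finsupp.degree_eq_weight_one]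
    exact hf (mem_support_iff.1 hμ)
  omega

lemma sub_homogeneousComponent_mem_degLT {d : ℕ} {f : MvPolynomial σ S}
    (hf : f ∈ degLT σ S (d + 1)) : f - homogeneousComponent d f ∈ degLT σ S d := by
  classical
  refine mem_degLT.2 fun μ hμ => ?_
  have h := mem_support_iff.1 hμ
  rw [coeff_sub, coeff_homogeneousComponent] at h
  split_ifs at h with h'
  · simp at h
  · have : μ.degree < d + 1 := hf (mem_support_iff.2 (by simpa using h))
    change μ.degree < d
    omega

lemma homogeneousComponent_mul_of_isHomogeneous {d e : ℕ} (f : MvPolynomial σ S)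
    {g : MvPolynomial σ S} (hg : g.IsHomogeneous e) :
    homogeneousComponent (d + e) (f * g) = homogeneousComponent d f * g := by
  classical
  have h1 : ∀ i, homogeneousComponent (d + e) (homogeneousComponent i f * g) =
      if d = i then homogeneousComponent d f * g else 0 := by
    intro i
    rw [homogeneousComponent_of_mem
      (((homogeneousComponent_isHomogeneous i f).mul hg) : _ ∈ homogeneousSubmodule σ S (i + e))]
    by_cases h : d = i
    · subst h; simp
    · rw [if_neg h, if_neg (by omega)]
  conv_lhs => rw [← sum_homogeneousComponent f]
  rw [Finset.sum_mul, map_sum]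
  simp only [h1]
  rw [Finset.sum_ite_eq]
  split_ifs with h
  · rfl
  · rw [homogeneousComponent_eq_zero _ _ (by simpa using h), zero_mul]

lemma homogeneousComponent_zero_mul_of_isHomogeneous {f g : MvPolynomial σ S}
    (hg : g.IsHomogeneous 1) : homogeneousComponent 0 (f * g) = 0 := by
  have h : coeff 0 g = 0 := hg.coeff_eq_zero (by simp)
  rw [homogeneousComponent_zero]
  simp only [← constantCoeff_eq, map_mul] at h ⊢
  rw [h, map_zero, mul_zero]

lemma homogeneousComponent_mem_degLT {d : ℕ} (f : MvPolynomial σ S) :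
    homogeneousComponent d f ∈ degLT σ S (d + 1) := by
  refine mem_degLT.2 fun μ hμ => ?_
  have := homogeneousComponent_isHomogeneous d f (mem_support_iff.1 hμ)
  have h2 : μ.degree = d := by
    rw [Finsupp.degree_eq_weight_one]
    exact this
  omega

lemma totalDegree_prod_C_add_le {ι : Type*} (s : Finset ι) (f : ι → S)
    (g : ι → MvPolynomial σ S) (hg : ∀ i, (g i).totalDegree ≤ 1) :
    (∏ i ∈ s, (C (f i) + g i)).totalDegree ≤ #s := by
  refine (totalDegree_finsetProd _ _).trans ?_
  rw [card_eq_sum_ones]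
  refine sum_le_sum fun i _ => (totalDegree_add _ _).trans ?_
  simp [hg i]

lemma prod_C_add_sub_mem_degLT {ι : Type*} (s : Finset ι) (f : ι → S)
    (g : ι → MvPolynomial σ S) (hg : ∀ i, (g i).totalDegree ≤ 1) :
    ∏ i ∈ s, (C (f i) + g i) - ∏ i ∈ s, g i ∈ degLT σ S #s := by
  classical
  induction s using Finset.induction_on with
  | empty => simp
  | insert j s hj ih =>
    rw [prod_insert hj, prod_insert hj, card_insert_of_notMem hj]
    have : (C (f j) + g j) * ∏ i ∈ s, (C (f i) + g i) - g j * ∏ i ∈ s, g i =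
        f j • ∏ i ∈ s, (C (f i) + g i) +
          (∏ i ∈ s, (C (f i) + g i) - ∏ i ∈ s, g i) * g j := by
      rw [smul_eq_C_mul]; ring
    rw [this]
    refine add_mem (Submodule.smul_mem _ _ (mem_degLT_of_totalDegree_lt ?_))
      (mul_mem_degLT ih (hg j))
    exact Nat.lt_succ_of_le (totalDegree_prod_C_add_le s f g hg)

end Degree

section StarMatrix
variable {S : Type*} [CommRing S] {p q : ℕ}

/-- The generic deformation `F + V · diag (ℓ j)` with `V` of Vandermonde type. -/
noncomputable def starMatrix (m : ℕ) (a : Fin q → S) (F : Matrix (Fin p) (Fin q) S) :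
    Matrix (Fin p) (Fin q) (MvPolynomial (Fin m) S) :=
  Matrix.of fun i j => C (F i j) + C (a j ^ (i : ℕ)) * powForm m (a j)

/-- The matrix with columns the powers of the nodes. -/
def nodeMatrix (p : ℕ) (a : Fin q → S) : Matrix (Fin p) (Fin q) S :=
  Matrix.of fun i j => a j ^ (i : ℕ)

/-- The minors of `starMatrix`, normalized to have leading form `∏ j ∈ c, powForm m (a j)`. -/
noncomputable def normMinor (m : ℕ) (a : Fin q → S) (F : Matrix (Fin p) (Fin q) S)
    (c : Finset (Fin q)) : MvPolynomial (Fin m) S :=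
  C (Ring.inverse (minorOn (nodeMatrix p a) c)) * minorOn (starMatrix m a F) c

variable {m : ℕ} {a : Fin q → S} {F : Matrix (Fin p) (Fin q) S}

lemma powForm_isHomogeneous (x : S) : (powForm m x).IsHomogeneous 1 :=
  IsHomogeneous.sum _ _ _ fun _ _ => isHomogeneous_C_mul_X _ _

lemma prod_powForm_isHomogeneous (c : Finset (Fin q)) :
    (∏ j ∈ c, powForm m (a j)).IsHomogeneous #c := by
  rw [card_eq_sum_ones]
  exact IsHomogeneous.prod _ _ _ fun j _ => powForm_isHomogeneous _

lemma isUnit_minorOn_nodeMatrix (ha : Pairwise fun i j => IsUnit (a i - a j))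
    {c : Finset (Fin q)} (hc : #c = p) : IsUnit (minorOn (nodeMatrix p a) c) := by
  rw [minorOn_eq _ hc, ← Matrix.det_transpose]
  exact isUnit_det_vandermonde (a := fun i => a (c.orderEmbOfFin hc i))
    fun i j hij => ha (fun h => hij ((c.orderEmbOfFin hc).injective h))

lemma minorOn_starMatrix_sub_mem {c : Finset (Fin q)} (hc : #c = p) :
    minorOn (starMatrix m a F) c - C (minorOn (nodeMatrix p a) c) * ∏ j ∈ c, powForm m (a j) ∈
      degLT (Fin m) S p := by
  have hprod : ∏ j ∈ c, powForm m (a j) = ∏ i, powForm m (a (c.orderEmbOfFin hc i)) := by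
    rw [← Finset.prod_coe_sort c]
    exact (Fintype.prod_equiv (c.orderIsoOfFin hc).toEquiv _ _ fun k => rfl).symm
  rw [minorOn_eq _ hc, minorOn_eq _ hc, hprod, Matrix.det_apply, Matrix.det_apply, map_sum,
    Finset.sum_mul, ← Finset.sum_sub_distrib]
  refine Submodule.sum_mem _ fun σ _ => ?_
  have h := prod_C_add_sub_mem_degLT (σ := Fin m) univ
    (fun i : Fin p => F (σ i) (c.orderEmbOfFin hc i))
    (fun i => C (a (c.orderEmbOfFin hc i) ^ (σ i : ℕ)) * powForm m (a (c.orderEmbOfFin hc i)))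
    (fun i => ((isHomogeneous_C _ _).mul (powForm_isHomogeneous _)).totalDegree_le)
  rw [card_univ, Fintype.card_fin, prod_mul_distrib, ← map_prod] at h
  have h2 : (Equiv.Perm.sign σ • ∏ i, ((starMatrix m a F).submatrix id (c.orderEmbOfFin hc)) (σ i) i
      - C (Equiv.Perm.sign σ • ∏ i, ((nodeMatrix p a).submatrix id (c.orderEmbOfFin hc)) (σ i) i) *
        ∏ i, powForm m (a (c.orderEmbOfFin hc i))) =
      ((Equiv.Perm.sign σ : ℤ) : S) • (∏ i : Fin p, (C (F (σ i) (c.orderEmbOfFin hc i)) +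
        C (a (c.orderEmbOfFin hc i) ^ (σ i : ℕ)) * powForm m (a (c.orderEmbOfFin hc i)))
      - C (∏ i : Fin p, (a (c.orderEmbOfFin hc i) ^ (σ i : ℕ))) *
        ∏ i, powForm m (a (c.orderEmbOfFin hc i))) := by
    simp only [starMatrix, nodeMatrix, Matrix.submatrix_apply, id, Matrix.of_apply,
      Units.smul_def, zsmul_eq_mul, smul_sub, smul_eq_C_mul, map_mul, map_intCast, mul_assoc]
  rw [h2]
  exact Submodule.smul_mem _ _ h

lemma normMinor_sub_mem (ha : Pairwise fun i j => IsUnit (a i - a j))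
    {c : Finset (Fin q)} (hc : #c = p) :
    normMinor m a F c - ∏ j ∈ c, powForm m (a j) ∈ degLT (Fin m) S p := by
  have h := Submodule.smul_mem _ (Ring.inverse (minorOn (nodeMatrix p a) c))
    (minorOn_starMatrix_sub_mem (m := m) (a := a) (F := F) hc)
  rwa [smul_eq_C_mul, mul_sub, ← mul_assoc, ← C_mul,
    Ring.inverse_mul_cancel _ (isUnit_minorOn_nodeMatrix ha hc), C_1, one_mul] at h

lemma minorOn_starMatrix_eq (ha : Pairwise fun i j => IsUnit (a i - a j))
    {c : Finset (Fin q)} (hc : #c = p) :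
    minorOn (starMatrix m a F) c = C (minorOn (nodeMatrix p a) c) * normMinor m a F c := by
  rw [normMinor, ← mul_assoc, ← C_mul,
    Ring.mul_inverse_cancel _ (isUnit_minorOn_nodeMatrix ha hc), C_1, one_mul]

lemma minorIdeal_starMatrix (ha : Pairwise fun i j => IsUnit (a i - a j)) :
    minorIdeal (starMatrix m a F) = Ideal.span (normMinor m a F '' {c | #c = p}) := by
  rw [minorIdeal_eq_span_minorOn]
  apply le_antisymm
  · refine Ideal.span_le.2 ?_
    rintro _ ⟨c, hc, rfl⟩
    rw [minorOn_starMatrix_eq ha hc]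
    exact Ideal.mul_mem_left _ _ (Ideal.subset_span ⟨c, hc, rfl⟩)
  · refine Ideal.span_le.2 ?_
    rintro _ ⟨c, hc, rfl⟩
    exact Ideal.mul_mem_left _ _ (Ideal.subset_span ⟨c, hc, rfl⟩)

/-- A vector dual to the column `j` among the columns `c` of `nodeMatrix`. -/
lemma exists_dual_nodeMatrix (ha : Pairwise fun i j => IsUnit (a i - a j))
    {c : Finset (Fin q)} (hc : #c = p) {j : Fin q} (hj : j ∈ c) :
    ∃ w : Fin p → S, ∀ j' ∈ c, ∑ i, w i * nodeMatrix p a i j' = if j' = j then 1 else 0 := by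
  have hdet := isUnit_minorOn_nodeMatrix ha hc
  rw [minorOn_eq _ hc] at hdet
  obtain ⟨k, rfl⟩ : ∃ k, c.orderEmbOfFin hc k = j := by
    have : j ∈ Set.range (c.orderEmbOfFin hc) := by simpa using hj
    exact this
  refine ⟨((nodeMatrix p a).submatrix id (c.orderEmbOfFin hc))⁻¹ k, fun j' hj' => ?_⟩
  obtain ⟨l, rfl⟩ : ∃ l, c.orderEmbOfFin hc l = j' := by
    have : j' ∈ Set.range (c.orderEmbOfFin hc) := by simpa using hj'
    exact this
  have := congrFun (congrFun (Matrix.nonsing_inv_mul _ hdet) k) l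
  rw [Matrix.mul_apply, Matrix.one_apply] at this
  simp only [(c.orderEmbOfFin hc).injective.eq_iff, eq_comm (a := l)]
  exact this

lemma normMinor_relation (ha : Pairwise fun i j => IsUnit (a i - a j)) {b : Finset (Fin q)}
    (hb : #b = p + 1) {j j' : Fin q} (hj : j ∈ b) (hj' : j' ∈ b) :
    ∃ e : Fin q → S, powForm m (a j) * normMinor m a F (b.erase j) -
      powForm m (a j') * normMinor m a F (b.erase j') =
        ∑ k ∈ b, C (e k) * normMinor m a F (b.erase k) := by
  by_cases hjj : j = j'
  · subst hjj
    exact ⟨0, by simp⟩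
  have hcard : ∀ k ∈ b, #(b.erase k) = p := fun k hk => by rw [card_erase_of_mem hk, hb]; rfl
  obtain ⟨w, hw⟩ := exists_dual_nodeMatrix ha (hcard j' hj') (mem_erase.2 ⟨hjj, hj⟩)
  set ε : Fin q → S := fun k => (-1) ^ #{i ∈ b | i < k} with hε
  set v : Fin q → S := fun k => minorOn (nodeMatrix p a) (b.erase k) with hv
  set u : Fin q → S := fun k => ∑ i, w i * nodeMatrix p a i k with hu
  have hu1 : u j = 1 := by simpa using hw j (mem_erase.2 ⟨hjj, hj⟩)
  have hu0 : ∀ k ∈ b, k ≠ j → k ≠ j' → u k = 0 := by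
    intro k hk hkj hkj'
    simpa [hkj] using hw k (mem_erase.2 ⟨hkj', hk⟩)
  have hεu : ∀ k, IsUnit (ε k) := fun k => (isUnit_one.neg).pow _
  have hκ : IsUnit (ε j * v j) := (hεu j).mul (isUnit_minorOn_nodeMatrix ha (hcard j hj))
  have hVrel : ε j * u j * v j + ε j' * u j' * v j' = 0 := by
    rw [← sum_rowComb_mul_minorOn_erase (nodeMatrix p a) w hb]
    symm
    refine Finset.sum_eq_add_of_mem j j' hj hj' hjj fun k hk hne => ?_
    have : ∑ i, w i * nodeMatrix p a i k = 0 := hu0 k hk hne.1 hne.2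
    rw [this, mul_zero, zero_mul]
  have hYrel := sum_rowComb_mul_minorOn_erase (starMatrix m a F) (fun i => C (w i)) hb
  have hterm : ∀ k ∈ b, (-1) ^ #{i ∈ b | i < k} * (∑ i, C (w i) * starMatrix m a F i k) *
      minorOn (starMatrix m a F) (b.erase k) =
      C (ε k * (∑ i, w i * F i k) * v k) * normMinor m a F (b.erase k) +
      C (ε k * u k * v k) * (powForm m (a k) * normMinor m a F (b.erase k)) := by
    intro k hk
    rw [minorOn_starMatrix_eq ha (hcard k hk)]
    have : ∑ i, C (w i) * starMatrix m a F i k =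
        C (∑ i, w i * F i k) + C (u k) * powForm m (a k) := by
      simp only [starMatrix, Matrix.of_apply, hu, nodeMatrix, map_sum, map_mul, Finset.sum_mul,
        ← Finset.sum_add_distrib]
      exact Finset.sum_congr rfl fun i _ => by ring
    rw [this]
    simp only [hε, hv, map_mul, map_pow, map_neg, map_one]
    ring
  rw [Finset.sum_congr rfl hterm, Finset.sum_add_distrib] at hYrel
  have hsum : ∑ k ∈ b, C (ε k * u k * v k) * (powForm m (a k) * normMinor m a F (b.erase k)) =
      C (ε j * v j) * (powForm m (a j) * normMinor m a F (b.erase j) -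
        powForm m (a j') * normMinor m a F (b.erase j')) := by
    rw [Finset.sum_eq_add_of_mem j j' hj hj' hjj]
    · have h1 : ε j' * u j' * v j' = -(ε j * v j) := by
        rw [hu1, mul_one] at hVrel
        exact (eq_neg_of_add_eq_zero_right hVrel)
      rw [h1, hu1, mul_one, map_neg]
      ring
    · intro k hk hne
      rw [hu0 k hk hne.1 hne.2]
      simp
  rw [hsum] at hYrel
  refine ⟨fun k => -(Ring.inverse (ε j * v j) * (ε k * (∑ i, w i * F i k) * v k)), ?_⟩
  have h2 := congrArg (fun f => C (Ring.inverse (ε j * v j)) * f) hYrel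
  simp only [mul_add, mul_zero] at h2
  rw [← mul_assoc (C _) (C _), ← C_mul, Ring.inverse_mul_cancel _ hκ, C_1, one_mul] at h2
  rw [eq_neg_of_add_eq_zero_right h2, Finset.mul_sum, ← Finset.sum_neg_distrib]
  refine Finset.sum_congr rfl fun k _ => ?_
  simp only [map_neg, map_mul]
  ring

end StarMatrix

section StarFlat
variable {S : Type*} [CommRing S] {p q m : ℕ} {a : Fin q → S} {F : Matrix (Fin p) (Fin q) S}

/-- The combinations of normalized minors, as a linear map in the coefficients. -/
noncomputable def normComb (m : ℕ) (a : Fin q → S) (F : Matrix (Fin p) (Fin q) S) :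
    (Finset (Fin q) → MvPolynomial (Fin m) S) →ₗ[S] MvPolynomial (Fin m) S :=
  ∑ c ∈ powersetCard p univ, (LinearMap.mulRight S (normMinor m a F c)) ∘ₗ LinearMap.proj c

/-- Combinations of normalized minors with coefficients of degree `< d`. -/
noncomputable def combLT (m : ℕ) (a : Fin q → S) (F : Matrix (Fin p) (Fin q) S) (d : ℕ) :
    Submodule S (MvPolynomial (Fin m) S) :=
  Submodule.map (normComb m a F) (Submodule.pi Set.univ fun _ => degLT (Fin m) S d)

lemma normComb_apply (A : Finset (Fin q) → MvPolynomial (Fin m) S) :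
    normComb m a F A = ∑ c ∈ powersetCard p univ, A c * normMinor m a F c := by
  simp [normComb]

lemma mul_normMinor_mem_combLT {d : ℕ} {x : MvPolynomial (Fin m) S} (hx : x ∈ degLT (Fin m) S d)
    {c : Finset (Fin q)} (hc : #c = p) : x * normMinor m a F c ∈ combLT m a F d := by
  refine ⟨Pi.single c x, ?_, ?_⟩
  · intro c' _
    by_cases h : c' = c
    · subst h; simpa using hx
    · simp [h]
  · rw [normComb_apply, Finset.sum_eq_single c]
    · simp
    · intro c' _ hc'
      simp [hc']
    · intro h
      exact (h (mem_powersetCard.2 ⟨subset_univ _, hc⟩)).elim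

lemma homogeneousComponent_powForm_mul (d : ℕ) (y : S) (x : MvPolynomial (Fin m) S) :
    homogeneousComponent d (powForm m y * x) =
      if d = 0 then 0 else powForm m y * homogeneousComponent (d - 1) x := by
  rw [mul_comm (powForm m y) x]
  rcases d with _ | d
  · simpa using homogeneousComponent_zero_mul_of_isHomogeneous (powForm_isHomogeneous y)
  · rw [homogeneousComponent_mul_of_isHomogeneous x (powForm_isHomogeneous y)]
    simp [mul_comm]

lemma homogeneousComponent_starRel_mem (ha : Pairwise fun i j => IsUnit (a i - a j)) (d : ℕ)
    {r : Finset (Fin q) → MvPolynomial (Fin m) S}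
    (hr : r ∈ starRel (fun j => powForm m (a j)) (MvPolynomial (Fin m) S) univ p) :
    normComb m a F (fun c => homogeneousComponent d (r c)) ∈ combLT m a F d := by
  have hadd : ∀ r r' : Finset (Fin q) → MvPolynomial (Fin m) S,
      normComb m a F (fun c => homogeneousComponent d ((r + r') c)) =
      normComb m a F (fun c => homogeneousComponent d (r c)) +
      normComb m a F (fun c => homogeneousComponent d (r' c)) := by
    intro r r'
    rw [← map_add]
    congr 1
    funext c
    simp
  induction hr using Submodule.closure_induction with
  | zero =>
    have : (fun c : Finset (Fin q) => homogeneousComponent d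
        ((0 : Finset (Fin q) → MvPolynomial (Fin m) S) c)) = 0 := by funext c; simp
    rw [this, map_zero]
    exact zero_mem _
  | add r r' _ _ h h' =>
    rw [hadd]
    exact add_mem h h'
  | smul_mem f v hv =>
    obtain ⟨b, -, hbc, j, hj, j', hj', x, rfl⟩ := hv
    have hsingle : ∀ k ∈ b, ∀ y : MvPolynomial (Fin m) S,
        normComb m a F (fun c => homogeneousComponent d
          ((Pi.single (b.erase k) y : Finset (Fin q) → MvPolynomial (Fin m) S) c)) =
        homogeneousComponent d y * normMinor m a F (b.erase k) := by
      intro k hk y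
      rw [normComb_apply, Finset.sum_eq_single (b.erase k)]
      · simp
      · intro c' _ hc'
        simp [hc']
      · intro h
        exact (h (mem_powersetCard.2 ⟨subset_univ _,
          by rw [card_erase_of_mem hk, hbc]; rfl⟩)).elim
    have hv : f • ((Pi.single (b.erase j) (powForm m (a j) • x) -
        Pi.single (b.erase j') (powForm m (a j') • x) :
          Finset (Fin q) → MvPolynomial (Fin m) S)) =
        Pi.single (b.erase j) (powForm m (a j) * (f * x)) +
        Pi.single (b.erase j') (powForm m (a j') * (-(f * x))) := by
      rw [smul_sub, ← Pi.single_smul', ← Pi.single_smul', sub_eq_add_neg, ← Pi.single_neg]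
      simp only [smul_eq_mul]
      congr 2 <;> ring
    rw [hv, hadd, hsingle j hj, hsingle j' hj', homogeneousComponent_powForm_mul,
      homogeneousComponent_powForm_mul]
    split_ifs with hd
    · simp
    · obtain ⟨d, rfl⟩ := Nat.exists_eq_succ_of_ne_zero hd
      simp only [Nat.succ_eq_add_one, Nat.add_sub_cancel]
      obtain ⟨e, he⟩ := normMinor_relation (m := m) (F := F) ha hbc hj hj'
      have h2 : powForm m (a j) * homogeneousComponent d (f * x) * normMinor m a F (b.erase j) +
          powForm m (a j') * homogeneousComponent d (-(f * x)) * normMinor m a F (b.erase j') =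
          ∑ k ∈ b, (e k • homogeneousComponent d (f * x)) * normMinor m a F (b.erase k) := by
        have h3 : ∑ k ∈ b, (e k • homogeneousComponent d (f * x)) * normMinor m a F (b.erase k) =
            homogeneousComponent d (f * x) * ∑ k ∈ b, C (e k) * normMinor m a F (b.erase k) := by
          rw [Finset.mul_sum]
          refine Finset.sum_congr rfl fun k _ => ?_
          rw [smul_eq_C_mul]; ring
        rw [h3, ← he, map_neg]
        ring
      rw [h2]
      refine Submodule.sum_mem _ fun k hk => mul_normMinor_mem_combLT
        (Submodule.smul_mem _ _ (homogeneousComponent_mem_degLT _)) ?_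
      rw [card_erase_of_mem hk, hbc]; rfl

lemma mul_normMinor_sub_mem_degLT (ha : Pairwise fun i j => IsUnit (a i - a j)) {d : ℕ}
    {x : MvPolynomial (Fin m) S} (hx : x ∈ degLT (Fin m) S (d + 1)) {c : Finset (Fin q)}
    (hc : #c = p) :
    x * normMinor m a F c - (∏ j ∈ c, powForm m (a j)) * homogeneousComponent d x ∈
      degLT (Fin m) S (d + p) := by
  set T := ∏ j ∈ c, powForm m (a j) with hT
  have hTd : T.totalDegree ≤ p := hc ▸ (prod_powForm_isHomogeneous c).totalDegree_le
  have h1 : x * normMinor m a F c - T * homogeneousComponent d x =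
      (normMinor m a F c - T) * x + (x - homogeneousComponent d x) * T := by ring
  rw [h1]
  refine add_mem ?_ (mul_mem_degLT (sub_homogeneousComponent_mem_degLT hx) hTd)
  have hxd : x.totalDegree ≤ d := by
    refine Finset.sup_le fun μ hμ => Nat.le_of_lt_succ (hx hμ)
  rw [add_comm d p]
  exact mul_mem_degLT (normMinor_sub_mem ha hc) hxd

lemma eq_zero_of_mem_combLT (hp : 1 ≤ p) (hq : q + 1 = m + p)
    (ha : Pairwise fun i j => IsUnit (a i - a j)) (d : ℕ) {f : MvPolynomial (Fin m) S}
    (hf : f ∈ combLT m a F d) (hfp : f ∈ degLT (Fin m) S p) : f = 0 := by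
  induction d with
  | zero =>
    obtain ⟨A, hA, rfl⟩ := hf
    rw [normComb_apply]
    refine Finset.sum_eq_zero fun c _ => ?_
    have : A c = 0 := by
      by_contra hne
      obtain ⟨μ, hμ⟩ := support_nonempty.2 hne
      exact absurd (hA c trivial hμ) (Nat.not_lt_zero _)
    rw [this, zero_mul]
  | succ d ih =>
    refine ih ?_
    obtain ⟨A, hA, hAf⟩ := hf
    let r : Finset (Fin q) → MvPolynomial (Fin m) S := fun c =>
      if c ∈ powersetCard p univ then homogeneousComponent d (A c) else 0
    have hr0 : starMap (fun j => powForm m (a j)) (MvPolynomial (Fin m) S) univ p r = 0 := by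
      have h1 : starMap (fun j => powForm m (a j)) (MvPolynomial (Fin m) S) univ p r =
          ∑ c ∈ powersetCard p univ,
            (∏ j ∈ c, powForm m (a j)) * homogeneousComponent d (A c) := by
        rw [starMap_apply]
        exact Finset.sum_congr rfl fun c hc => by simp only [r, if_pos hc, smul_eq_mul]
      rw [h1]
      refine eq_zero_of_isHomogeneous_of_mem_degLT le_rfl (d := d + p) ?_ ?_
      · refine IsHomogeneous.sum _ _ _ fun c hc => ?_
        have h2 := (prod_powForm_isHomogeneous (m := m) (a := a) c).mul
          (homogeneousComponent_isHomogeneous d (A c))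
        rwa [(mem_powersetCard.1 hc).2, add_comm] at h2
      · have h2 : ∑ c ∈ powersetCard p univ,
            (∏ j ∈ c, powForm m (a j)) * homogeneousComponent d (A c) =
            f - ∑ c ∈ powersetCard p univ, (A c * normMinor m a F c -
              (∏ j ∈ c, powForm m (a j)) * homogeneousComponent d (A c)) := by
          rw [← hAf, normComb_apply, Finset.sum_sub_distrib]
          abel
        rw [h2]
        refine sub_mem (degLT_mono (by omega) hfp) (Submodule.sum_mem _ fun c hc => ?_)
        exact mul_normMinor_sub_mem_degLT ha (hA c trivial) (mem_powersetCard.1 hc).2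
    have hr := mem_starRel_of_starMap_eq_zero univ m p (by simpa using hq)
      (fun L hL _ hLm => isWeaklyRegular_powForm (by omega) ha hL hLm) r
      (fun c hc => if_neg hc) hr0
    have h3 := homogeneousComponent_starRel_mem (F := F) ha d hr
    have h4 : f = normComb m a F (fun c => homogeneousComponent d (r c)) +
        normComb m a F (fun c => A c - homogeneousComponent d (A c)) := by
      rw [← hAf, normComb_apply, normComb_apply, normComb_apply, ← Finset.sum_add_distrib]
      refine Finset.sum_congr rfl fun c hc => ?_
      have : homogeneousComponent d (r c) = homogeneousComponent d (A c) := by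
        simp only [r, if_pos hc]
        exact homogeneousComponent_eq_self (homogeneousComponent_isHomogeneous d (A c))
      rw [this]
      ring
    rw [h4]
    exact add_mem h3 ⟨_, fun c _ => sub_homogeneousComponent_mem_degLT (hA c trivial), rfl⟩

lemma X_mem_span_powForm (ha : Pairwise fun i j => IsUnit (a i - a j)) {U : Finset (Fin q)}
    (hU : m ≤ #U) (r : Fin m) :
    (X r : MvPolynomial (Fin m) S) ∈ Ideal.span ((fun j => powForm m (a j)) '' U) := by
  obtain ⟨U', hU', hc⟩ := exists_subset_card_eq hU
  have hW : IsUnit (Matrix.vandermonde fun i : Fin m => a (U'.orderEmbOfFin hc i)).det :=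
    isUnit_det_vandermonde fun i j hij => ha (fun h => hij ((U'.orderEmbOfFin hc).injective h))
  set φ := linearChange _ hW
  have h1 : φ.symm (X r) = ∑ i, C ((Matrix.vandermonde fun i : Fin m =>
      a (U'.orderEmbOfFin hc i))⁻¹ r i) * X i := by
    change aeval (fun i => ∑ l, C ((Matrix.vandermonde fun i : Fin m =>
      a (U'.orderEmbOfFin hc i))⁻¹ i l) * X l) (X r) = _
    simp
  rw [← φ.apply_symm_apply (X r), h1, map_sum]
  refine Ideal.sum_mem _ fun i _ => ?_
  rw [map_mul]
  refine Ideal.mul_mem_left _ _ ?_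
  rw [show φ (X i) = _ from linearChange_X _ hW i]
  exact Ideal.subset_span ⟨U'.orderEmbOfFin hc i, hU' (orderEmbOfFin_mem _ _ _), rfl⟩

lemma idealOfVars_pow_le (hq : q + 1 = m + p) (ha : Pairwise fun i j => IsUnit (a i - a j))
    (p' : ℕ) (hp' : p' ≤ p) :
    idealOfVars (Fin m) S ^ p' ≤
      Ideal.span ((fun c => ∏ j ∈ c, powForm m (a j)) '' {c : Finset (Fin q) | #c = p'}) := by
  induction p' with
  | zero =>
    rw [pow_zero, Ideal.one_eq_top, ← Ideal.span_singleton_one]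
    exact Ideal.span_mono (by
      rintro _ rfl
      exact ⟨∅, by simp, by simp⟩)
  | succ p' ih =>
    rw [pow_succ]
    refine (Ideal.mul_mono_left (ih (by omega))).trans ?_
    rw [idealOfVars, Ideal.span_mul_span, Ideal.span_le]
    rintro _ ⟨_, ⟨c, hc, rfl⟩, _, ⟨r, rfl⟩, rfl⟩
    have hc' : #c = p' := hc
    have hX := X_mem_span_powForm (m := m) ha (U := univ \ c) (by
      rw [card_sdiff_of_subset (subset_univ _), card_fin, hc']; omega) r
    have hle : Ideal.span {∏ j ∈ c, powForm m (a j)} * Ideal.span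
        ((fun j => powForm m (a j)) '' (univ \ c : Finset (Fin q))) ≤
        Ideal.span ((fun c => ∏ j ∈ c, powForm m (a j)) '' {c : Finset (Fin q) | #c = p' + 1}) := by
      rw [Ideal.span_mul_span, Ideal.span_le]
      rintro _ ⟨_, rfl, _, ⟨j, hj, rfl⟩, rfl⟩
      have hj' : j ∉ c := by simpa using hj
      refine Ideal.subset_span ⟨insert j c, ?_, ?_⟩
      · change #(insert j c) = p' + 1
        rw [card_insert_of_notMem hj', hc']
      · simp only [prod_insert hj', mul_comm]
    exact hle (Ideal.mul_mem_mul (Ideal.mem_span_singleton_self _) hX)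

lemma exists_sub_mem_degLT (hq : q + 1 = m + p) (ha : Pairwise fun i j => IsUnit (a i - a j))
    (d : ℕ) {f : MvPolynomial (Fin m) S} (hf : f ∈ degLT (Fin m) S d) :
    ∃ g ∈ minorIdeal (starMatrix m a F), f - g ∈ degLT (Fin m) S p := by
  induction d generalizing f with
  | zero => exact ⟨0, zero_mem _, by simpa using degLT_mono (Nat.zero_le _) hf⟩
  | succ d ih =>
    by_cases hd : d + 1 ≤ p
    · exact ⟨0, zero_mem _, by simpa using degLT_mono hd hf⟩
    obtain ⟨e, rfl⟩ : ∃ e, d = e + p := ⟨d - p, by omega⟩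
    have hmem : homogeneousComponent (e + p) f ∈ idealOfVars (Fin m) S ^ p := by
      rw [mem_pow_idealOfVars_iff']
      intro μ hμ
      refine (homogeneousComponent_isHomogeneous (e + p) f).coeff_eq_zero ?_
      omega
    have hmem2 := idealOfVars_pow_le hq ha p le_rfl hmem
    -- rewrite the top component as a combination of the products
    have key : ∀ h ∈ Ideal.span ((fun c => ∏ j ∈ c, powForm m (a j)) ''
        {c : Finset (Fin q) | #c = p}), ∃ g ∈ minorIdeal (starMatrix m a F),
          homogeneousComponent (e + p) h - g ∈ degLT (Fin m) S (e + p) := by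
      intro h hh
      induction hh using Submodule.closure_induction with
      | zero => exact ⟨0, zero_mem _, by simp⟩
      | add x y _ _ hx hy =>
        obtain ⟨g, hg, hg'⟩ := hx
        obtain ⟨k, hk, hk'⟩ := hy
        refine ⟨g + k, add_mem hg hk, ?_⟩
        rw [map_add, add_sub_add_comm]
        exact add_mem hg' hk'
      | smul_mem x y hy =>
        obtain ⟨c, hc, rfl⟩ := hy
        have hc' : #c = p := hc
        refine ⟨homogeneousComponent e x * normMinor m a F c, ?_, ?_⟩
        · rw [minorIdeal_starMatrix ha]
          exact Ideal.mul_mem_left _ _ (Ideal.subset_span ⟨c, hc, rfl⟩)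
        · have h1 := mul_normMinor_sub_mem_degLT (F := F) ha
            (homogeneousComponent_mem_degLT (d := e) x) hc'
          have h2 : homogeneousComponent (e + p) (x * ∏ j ∈ c, powForm m (a j)) =
              homogeneousComponent e x * ∏ j ∈ c, powForm m (a j) :=
            homogeneousComponent_mul_of_isHomogeneous x (hc' ▸ prod_powForm_isHomogeneous c)
          rw [homogeneousComponent_eq_self (homogeneousComponent_isHomogeneous e x)] at h1
          rw [smul_eq_mul, h2, ← neg_mem_iff]
          convert h1 using 1
          ring
    obtain ⟨g, hg, hg'⟩ := key _ hmem2
    rw [homogeneousComponent_eq_self (homogeneousComponent_isHomogeneous (e + p) f)] at hg'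
    have h3 : f - g ∈ degLT (Fin m) S (e + p) := by
      have := add_mem (sub_homogeneousComponent_mem_degLT hf) hg'
      simpa using this
    obtain ⟨k, hk, hk'⟩ := ih h3
    exact ⟨g + k, add_mem hg hk, by rwa [← sub_sub]⟩

/-- The deformed determinantal ring is flat over the base. -/
theorem flat_quotient_minorIdeal_starMatrix (hp : 1 ≤ p) (hq : q + 1 = m + p)
    (ha : Pairwise fun i j => IsUnit (a i - a j)) :
    Module.Flat S (MvPolynomial (Fin m) S ⧸ minorIdeal (starMatrix m a F)) := by
  have hcompl : IsCompl ((minorIdeal (starMatrix m a F)).restrictScalars S)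
      (degLT (Fin m) S p) := by
    constructor
    · rw [Submodule.disjoint_def]
      intro f hf hfp
      have hf' : f ∈ Ideal.span (normMinor m a F '' {c | #c = p}) := by
        rw [← minorIdeal_starMatrix ha]; exact hf
      obtain ⟨d, hd⟩ : ∃ d, f ∈ combLT m a F d := by
        clear hfp hf
        induction hf' using Submodule.closure_induction with
        | zero => exact ⟨0, zero_mem _⟩
        | add x y _ _ hx hy =>
          obtain ⟨d, hd⟩ := hx
          obtain ⟨e, he⟩ := hy
          have hmono : ∀ {d d'}, d ≤ d' → combLT m a F d ≤ combLT m a F d' := fun h =>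
            Submodule.map_mono (Submodule.pi_mono fun _ _ => degLT_mono h)
          exact ⟨max d e, add_mem (hmono (le_max_left _ _) hd) (hmono (le_max_right _ _) he)⟩
        | smul_mem x y hy =>
          obtain ⟨c, hc, rfl⟩ := hy
          exact ⟨x.totalDegree + 1, mul_normMinor_mem_combLT
            (mem_degLT_of_totalDegree_lt (Nat.lt_succ_self _)) hc⟩
      exact eq_zero_of_mem_combLT hp hq ha d hd hfp
    · rw [codisjoint_iff, eq_top_iff]
      intro f _
      obtain ⟨g, hg, hg'⟩ := exists_sub_mem_degLT (F := F) hq ha (f.totalDegree + 1)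
        (mem_degLT_of_totalDegree_lt (Nat.lt_succ_self _))
      exact Submodule.mem_sup.2 ⟨g, hg, f - g, hg', by ring⟩
  have hfree : Module.Free S (degLT (Fin m) S p) :=
    Module.Free.of_basis (basisRestrictSupport S _)
  exact Module.Flat.of_linearEquiv ((Submodule.Quotient.restrictScalarsEquiv S _).symm.trans
    (Submodule.quotientEquivOfIsCompl _ _ hcompl))

end StarFlat

section LocalFlat
variable {R : Type*} [CommRing R] {p q m s : ℕ}

lemma map_algebraMap_minorIdeal_le (a : Fin q → R) (F : Matrix (Fin p) (Fin q) R) :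
    (minorIdeal F).map (algebraMap R (MvPolynomial (Fin m) R ⧸ minorIdeal (starMatrix m a F))) ≤
      Ideal.ofList ((List.finRange m).map fun i =>
        Ideal.Quotient.mk (minorIdeal (starMatrix m a F)) (X i)) := by
  set J := minorIdeal (starMatrix m a F)
  set P := Ideal.ofList ((List.finRange m).map fun i => Ideal.Quotient.mk J (X i)) with hP
  have hX : ∀ i, Ideal.Quotient.mk P (Ideal.Quotient.mk J (X i)) = 0 := fun i =>
    Ideal.Quotient.eq_zero_iff_mem.2 (Ideal.subset_span (by simp))
  have hF : (F.map (algebraMap R (MvPolynomial (Fin m) R ⧸ J))).map (Ideal.Quotient.mk P) =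
      (starMatrix m a F).map ((Ideal.Quotient.mk P).comp (Ideal.Quotient.mk J)) := by
    ext i j
    simp only [starMatrix, powForm, Matrix.map_apply, Matrix.of_apply, RingHom.comp_apply, map_add,
      map_mul, map_sum, hX]
    simp
    rfl
  have h0 : ((minorIdeal F).map (algebraMap R (MvPolynomial (Fin m) R ⧸ J))).map
      (Ideal.Quotient.mk P) = ⊥ := by
    rw [minorIdeal_map, minorIdeal_map, hF, ← minorIdeal_map, ← Ideal.map_map,
      Ideal.map_quotient_self, Ideal.map_bot]
  have h1 := Ideal.map_eq_bot_iff_le_ker _ |>.1 h0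
  rwa [Ideal.mk_ker] at h1

/-- If a weakly regular sequence of the expected length lies in the radical of the ideal
generated by `t`, the maximal minors of `F` and the `g i`, then `t` is regular modulo the latter. -/
theorem mem_of_mul_mem_minorIdeal (hp : 1 ≤ p) (hq : q + 1 = m + p) {a : Fin q → R}
    (ha : Pairwise fun i j => IsUnit (a i - a j)) (F : Matrix (Fin p) (Fin q) R) (g : Fin s → R)
    {t : R} {rs : List R} (hreg : RingTheory.Sequence.IsWeaklyRegular R rs)
    (hlen : rs.length = m + s + 1)
    (hmem : ∀ r ∈ rs, r ∈ (Ideal.span {t} ⊔ (minorIdeal F ⊔ Ideal.span (Set.range g))).radical)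
    {b : R} (hb : t * b ∈ minorIdeal F ⊔ Ideal.span (Set.range g)) :
    b ∈ minorIdeal F ⊔ Ideal.span (Set.range g) := by
  set J := minorIdeal (starMatrix m a F) with hJ
  set I := minorIdeal F ⊔ Ideal.span (Set.range g) with hI
  have := flat_quotient_minorIdeal_starMatrix (F := F) hp hq ha
  let φ : R →+* MvPolynomial (Fin m) R ⧸ J := algebraMap R _
  let zs : List (MvPolynomial (Fin m) R ⧸ J) :=
    (List.finRange m).map fun i => Ideal.Quotient.mk J (X i)
  let gs : List (MvPolynomial (Fin m) R ⧸ J) := (List.finRange s).map fun i => φ (g i)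
  have hIle : I.map φ ≤ Ideal.ofList (zs ++ gs) := by
    rw [hI, Ideal.map_sup, Ideal.ofList_append]
    refine sup_le_sup (map_algebraMap_minorIdeal_le a F) ?_
    rw [Ideal.map_span, Ideal.span_le]
    rintro _ ⟨_, ⟨i, rfl⟩, rfl⟩
    exact Ideal.subset_span (by simp [gs])
  have hregC : RingTheory.Sequence.IsWeaklyRegular (MvPolynomial (Fin m) R ⧸ J) (rs.map φ) :=
    hreg.of_flat
  have key := mem_of_smul_mem_of_isWeaklyRegular (y := φ t) (ys := zs ++ gs) (x := φ b) hregC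
    (by
      intro r hr
      obtain ⟨r, hr', rfl⟩ := List.mem_map.1 hr
      obtain ⟨N, hN⟩ := hmem r hr'
      refine ⟨N, ?_⟩
      have h2 := Ideal.mem_map_of_mem φ hN
      rw [map_pow, Ideal.map_sup, Ideal.map_span, Set.image_singleton] at h2
      rw [Ideal.ofList_cons]
      exact sup_le_sup le_rfl hIle h2)
    (by simp [zs, gs, hlen])
    (by
      rw [smul_eq_mul, smul_eq_mul, Ideal.mul_top, ← map_mul]
      exact hIle (Ideal.mem_map_of_mem φ hb))
  rw [smul_eq_mul, Ideal.mul_top] at key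
  let ψ₀ : MvPolynomial (Fin m) R →+* R ⧸ I := eval₂Hom (Ideal.Quotient.mk I) fun _ => 0
  have hψ₀ : ∀ x ∈ J, ψ₀ x = 0 := by
    have : J.map ψ₀ = ⊥ := by
      rw [hJ, minorIdeal_map]
      have : (starMatrix m a F).map ψ₀ = F.map (Ideal.Quotient.mk I) := by
        ext i j
        simp [ψ₀, starMatrix, powForm]
      rw [this, ← minorIdeal_map, Ideal.map_eq_bot_iff_le_ker, Ideal.mk_ker]
      exact le_sup_left
    intro x hx
    have := this ▸ Ideal.mem_map_of_mem ψ₀ hx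
    simpa using this
  let ψ : MvPolynomial (Fin m) R ⧸ J →+* R ⧸ I := Ideal.Quotient.lift J ψ₀ hψ₀
  have hψφ : ∀ x, ψ (φ x) = Ideal.Quotient.mk I x := by
    intro x
    change ψ (Ideal.Quotient.mk J (C x)) = _
    simp [ψ, ψ₀]
  have h3 : Ideal.ofList (zs ++ gs) ≤ RingHom.ker ψ := by
    rw [Ideal.ofList, Ideal.span_le]
    intro x hx
    simp only [Set.mem_ofPred_eq, List.mem_append, zs, gs, List.mem_map, List.mem_finRange,
      true_and] at hx
    rcases hx with ⟨i, rfl⟩ | ⟨i, rfl⟩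
    · simp [ψ, ψ₀]
    · change ψ (φ (g i)) = 0
      rw [hψφ, Ideal.Quotient.eq_zero_iff_mem]
      exact le_sup_right (α := Ideal R) (Ideal.subset_span ⟨i, rfl⟩)
  have h4 : ψ (φ b) = 0 := h3 key
  rwa [hψφ, Ideal.Quotient.eq_zero_iff_mem] at h4

/-- Version of `mem_of_mul_mem_minorIdeal` on a principal open set. -/
theorem exists_pow_mul_mem_minorIdeal (hp : 1 ≤ p) (hq : q + 1 = m + p) {a : Fin q → R}
    (ha : Pairwise fun i j => IsUnit (a i - a j)) (F : Matrix (Fin p) (Fin q) R) (g : Fin s → R)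
    {t h : R} {rs : List R} (hreg : RingTheory.Sequence.IsWeaklyRegular R rs)
    (hlen : rs.length = m + s + 1)
    (hmem : ∀ r ∈ rs,
      h * r ∈ (Ideal.span {t} ⊔ (minorIdeal F ⊔ Ideal.span (Set.range g))).radical)
    {b : R} (hb : t * b ∈ minorIdeal F ⊔ Ideal.span (Set.range g)) :
    ∃ N, h ^ N * b ∈ minorIdeal F ⊔ Ideal.span (Set.range g) := by
  let φ : R →+* Localization.Away h := algebraMap R _
  set I := minorIdeal F ⊔ Ideal.span (Set.range g) with hI
  have hmap : I.map φ = minorIdeal (F.map φ) ⊔ Ideal.span (Set.range fun i => φ (g i)) := by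
    rw [hI, Ideal.map_sup, minorIdeal_map, Ideal.map_span, ← Set.range_comp]
    rfl
  have hu : IsUnit (φ h) := IsLocalization.Away.algebraMap_isUnit h
  have key : φ b ∈ I.map φ := by
    rw [hmap]
    refine mem_of_mul_mem_minorIdeal (t := φ t) (rs := rs.map φ) (a := fun i => φ (a i)) hp hq
      ?_ _ _ (hreg.of_isLocalization _ (Submonoid.powers h)) (by simpa using hlen) ?_ ?_
    · intro i j hij
      have := (ha hij).map φ
      rwa [map_sub] at this
    · intro r hr
      obtain ⟨r, hr', rfl⟩ := List.mem_map.1 hr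
      obtain ⟨N, hN⟩ := hmem r hr'
      refine ⟨N, ?_⟩
      have h2 := Ideal.mem_map_of_mem φ hN
      rw [map_pow, Ideal.map_sup, Ideal.map_span, Set.image_singleton, hmap, map_mul,
        mul_pow] at h2
      exact (Ideal.unit_mul_mem_iff_mem _ (hu.pow N)).1 h2
    · rw [← hmap, ← map_mul]
      exact Ideal.mem_map_of_mem φ hb
  obtain ⟨_, ⟨N, rfl⟩, hN⟩ :=
    (IsLocalization.algebraMap_mem_map_algebraMap_iff (Submonoid.powers h) _ _ _).1 key
  exact ⟨N, hN⟩

end LocalFlat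

section Deformation

/-- Translation of the coordinates. -/
noncomputable def translate {σ S : Type*} [CommRing S] (a : σ → S) :
    MvPolynomial σ S ≃ₐ[S] MvPolynomial σ S :=
  AlgEquiv.ofAlgHom (aeval fun v => X v + C (a v)) (aeval fun v => X v - C (a v))
    (by ext v; simp) (by ext v; simp)

variable {k : Type*} [Field k] {n : ℕ}

/-- Coefficientwise specialization of the deformation parameter. -/
noncomputable abbrev spec (n : ℕ) (c : k) :
    MvPolynomial (Fin n) (Polynomial k) →+* MvPolynomial (Fin n) k :=
  MvPolynomial.map (Polynomial.evalRingHom c)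

/-- Constant families. -/
noncomputable abbrev constFam (n : ℕ) (k : Type*) [Field k] :
    MvPolynomial (Fin n) k →+* MvPolynomial (Fin n) (Polynomial k) :=
  MvPolynomial.map Polynomial.C

lemma spec_constFam (c : k) (f : MvPolynomial (Fin n) k) : spec n c (constFam n k f) = f := by
  rw [spec, constFam, MvPolynomial.map_map]
  convert MvPolynomial.map_id f
  ext; simp

lemma exists_of_spec_eq_zero {c : k} {f : MvPolynomial (Fin n) (Polynomial k)}
    (hf : spec n c f = 0) : ∃ g, f = C (Polynomial.X - Polynomial.C c) * g := by
  change C (Polynomial.X - Polynomial.C c) ∣ f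
  rw [C_dvd_iff_dvd_coeff]
  intro d
  rw [Polynomial.dvd_iff_isRoot, Polynomial.IsRoot.def]
  have := congrArg (coeff d) hf
  simpa [spec, coeff_map] using this

lemma isWeaklyRegular_translate (ξ : Fin n → k) :
    RingTheory.Sequence.IsWeaklyRegular (MvPolynomial (Fin n) (Polynomial k))
      (C Polynomial.X :: (List.finRange n).map fun i => X i - C (Polynomial.C (ξ i))) := by
  have h1 : RingTheory.Sequence.IsWeaklyRegular (MvPolynomial (Option (Fin n)) k)
      ((none :: (List.finRange n).map some).map (X : Option (Fin n) → MvPolynomial _ k)) := by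
    refine isWeaklyRegular_map_X ?_
    simp [List.nodup_finRange, List.nodup_map_iff (Option.some_injective _)]
  let e : MvPolynomial (Option (Fin n)) k ≃+* MvPolynomial (Fin n) (Polynomial k) :=
    (optionEquivRight k (Fin n)).toRingEquiv.trans
      (translate fun i => Polynomial.C (ξ i)).symm.toRingEquiv
  have h2 : C Polynomial.X :: (List.finRange n).map (fun i => X i - C (Polynomial.C (ξ i))) =
      ((none :: (List.finRange n).map some).map
        (X : Option (Fin n) → MvPolynomial _ k)).map e := by
    have h3 : e (X none) = C Polynomial.X := by
      change (translate fun i => Polynomial.C (ξ i)).symm (optionEquivRight k (Fin n) (X none)) = _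
      rw [optionEquivRight_X_none]
      exact (translate fun i => Polynomial.C (ξ i)).symm.commutes _
    have h4 : ∀ i, e (X (some i)) = X i - C (Polynomial.C (ξ i)) := by
      intro i
      change (translate fun i => Polynomial.C (ξ i)).symm
        (optionEquivRight k (Fin n) (X (some i))) = _
      rw [optionEquivRight_X_some]
      simp [translate]
    rw [List.map_cons, List.map_cons, h3, List.map_map, List.map_map]
    congr 1
    exact List.map_congr_left fun i _ => (h4 i).symm
  rw [h2]
  exact isWeaklyRegular_map_ringEquiv e h1

variable [IsAlgClosed k]

lemma mul_X_sub_C_mem_radical {I : Ideal (MvPolynomial (Fin n) k)} {ξ : Fin n → k}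
    {h : MvPolynomial (Fin n) k}
    (hh : ∀ y : Fin n → k, (∀ f ∈ I, eval y f = 0) → eval y h ≠ 0 → y = ξ) (i : Fin n) :
    h * (X i - C (ξ i)) ∈ I.radical := by
  rw [← vanishingIdeal_zeroLocus_eq_radical (K := k)]
  intro y hy
  rw [mem_zeroLocus_iff] at hy
  have hy' : ∀ f ∈ I, eval y f = 0 := fun f hf => by simpa [aeval_eq_eval] using hy f hf
  by_cases h0 : eval y h = 0
  · simp [aeval_eq_eval, h0]
  · simp [aeval_eq_eval, hh y hy' h0]

variable {p q m s : ℕ}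

/-- Near an isolated point of the special fibre the deformation parameter is regular. -/
theorem exists_pow_mul_mem_of_isolated (hp : 1 ≤ p) (hq : q + 1 = m + p) (hn : n = m + s)
    (F : Matrix (Fin p) (Fin q) (MvPolynomial (Fin n) (Polynomial k)))
    (g : Fin s → MvPolynomial (Fin n) (Polynomial k)) {ξ : Fin n → k}
    {h : MvPolynomial (Fin n) k}
    (hh : ∀ y : Fin n → k, (∀ f ∈ (minorIdeal F ⊔ Ideal.span (Set.range g)).map (spec n 0),
      eval y f = 0) → eval y h ≠ 0 → y = ξ)
    {b : MvPolynomial (Fin n) (Polynomial k)}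
    (hb : C Polynomial.X * b ∈ minorIdeal F ⊔ Ideal.span (Set.range g)) :
    ∃ N, constFam n k h ^ N * b ∈ minorIdeal F ⊔ Ideal.span (Set.range g) := by
  set I := minorIdeal F ⊔ Ideal.span (Set.range g) with hI
  have hlift : ∀ f ∈ I.map (spec n 0), constFam n k f ∈ Ideal.span {C Polynomial.X} ⊔ I := by
    intro f hf
    obtain ⟨f', hf', rfl⟩ := (Ideal.mem_map_iff_of_surjective (spec n 0)
      fun x => ⟨_, spec_constFam 0 x⟩).1 hf
    obtain ⟨u, hu⟩ := exists_of_spec_eq_zero (c := (0 : k))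
      (f := constFam n k (spec n 0 f') - f') (by rw [map_sub, spec_constFam, sub_self])
    rw [map_zero, sub_zero] at hu
    rw [eq_add_of_sub_eq hu]
    exact add_mem (Ideal.mem_sup_left (Ideal.mul_mem_right _ _ (Ideal.mem_span_singleton_self _)))
      (Ideal.mem_sup_right hf')
  obtain ⟨a, ha⟩ := (Infinite.natEmbedding k).injective.comp Fin.val_injective |>
    fun h => (⟨fun i : Fin q => _, h⟩ : ∃ a : Fin q → k, Function.Injective a)
  refine exists_pow_mul_mem_minorIdeal hp hq (a := fun i => C (Polynomial.C (a i))) ?_ F g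
    (isWeaklyRegular_translate ξ) (by simp [hn]) ?_ hb
  · intro i j hij
    have : IsUnit (a i - a j) := (sub_ne_zero.2 (ha.ne hij)).isUnit
    have := this.map ((C : Polynomial k →+* MvPolynomial (Fin n) (Polynomial k)).comp Polynomial.C)
    simpa using this
  · intro r hr
    rcases List.mem_cons.1 hr with rfl | hr
    · exact Ideal.le_radical (Ideal.mul_mem_left _ _ (Ideal.mem_sup_left
        (Ideal.mem_span_singleton_self _)))
    · obtain ⟨i, -, rfl⟩ := List.mem_map.1 hr
      obtain ⟨N, hN⟩ := mul_X_sub_C_mem_radical hh i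
      refine ⟨N, ?_⟩
      have := hlift _ hN
      simpa using this

end Deformation

section Codim
variable {k A : Type*} [Field k] [CommRing A] [Algebra k A]

/-- `J` has codimension at most `B`, witnessed by a spanning family of the quotient. -/
def CodimLE (k : Type*) {A : Type*} [Field k] [CommRing A] [Algebra k A] (J : Ideal A) (B : ℕ) :
    Prop :=
  ∃ v : Fin B → A, ∀ a, ∃ u : Fin B → k, a - ∑ i, u i • v i ∈ J

lemma CodimLE.mono {J J' : Ideal A} {B : ℕ} (h : CodimLE k J B) (hJ : J ≤ J') : CodimLE k J' B := by
  obtain ⟨v, hv⟩ := h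
  exact ⟨v, fun a => (hv a).imp fun _ hu => hJ hu⟩

lemma codimLE_top : CodimLE k (⊤ : Ideal A) 0 := ⟨fun i => i.elim0, fun _ => ⟨fun i => i.elim0, trivial⟩⟩

lemma CodimLE.of_mul {J J' : Ideal A} {x : A} {B B' : ℕ} (h : CodimLE k (J ⊔ Ideal.span {x}) B)
    (h' : CodimLE k J' B') (hx : ∀ a ∈ J', x * a ∈ J) : CodimLE k J (B + B') := by
  obtain ⟨v, hv⟩ := h
  obtain ⟨v', hv'⟩ := h'
  refine ⟨Fin.append v fun i => x * v' i, fun a => ?_⟩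
  obtain ⟨u, hu⟩ := hv a
  obtain ⟨j, hj, w, hw, hjw⟩ := Submodule.mem_sup.1 hu
  obtain ⟨c, rfl⟩ := Ideal.mem_span_singleton'.1 hw
  obtain ⟨u', hu'⟩ := hv' c
  refine ⟨Fin.append u u', ?_⟩
  have h1 := add_mem hj (hx _ hu')
  convert h1 using 1
  simp only [Fin.sum_univ_add, Fin.append_left, Fin.append_right]
  rw [← sub_sub, ← hjw, mul_sub, Finset.mul_sum]
  simp only [mul_smul_comm]
  ring

lemma CodimLE.pow {J : Ideal A} {y : A} {B : ℕ} (h : CodimLE k (J ⊔ Ideal.span {y}) B) (a : ℕ) :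
    CodimLE k (J ⊔ Ideal.span {y ^ a}) (a * B) := by
  induction a with
  | zero => simpa using codimLE_top
  | succ a ih =>
    rw [Nat.succ_mul]
    refine CodimLE.of_mul (x := y ^ a) (ih.mono (sup_le_sup_right le_sup_left _)) h fun b hb => ?_
    obtain ⟨j, hj, w, hw, rfl⟩ := Submodule.mem_sup.1 hb
    obtain ⟨c, rfl⟩ := Ideal.mem_span_singleton'.1 hw
    rw [mul_add]
    refine add_mem (Ideal.mem_sup_left (Ideal.mul_mem_left _ _ hj)) (Ideal.mem_sup_right ?_)
    exact Ideal.mem_span_singleton'.2 ⟨c, by ring⟩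

/-- Entries of a band matrix of powers. -/
def bandEntry (y : ℕ → A) (α : ℕ → ℕ) (m i j : ℕ) : A :=
  if i ≤ j ∧ j < i + m then y (j - i) ^ α i else 0

/-- The ideal of the maximal minors of the band matrix with `p` rows. -/
def bandIdeal (y : ℕ → A) (α : ℕ → ℕ) (m p : ℕ) : Ideal A :=
  Ideal.span (Set.range fun c : Fin p → ℕ =>
    (Matrix.of fun i j : Fin p => bandEntry y α m i (c j)).det)

/-- Complete homogeneous symmetric functions, by recursion. -/
def hrec (α : ℕ → ℕ) : ℕ → ℕ → ℕ
  | 0, _ => 1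
  | _ + 1, 0 => 0
  | m + 1, p + 1 => α p * hrec α m (p + 1) + hrec α (m + 1) p

lemma mul_mem_bandIdeal (y : ℕ → A) (α : ℕ → ℕ) (m p : ℕ) {b : A}
    (hb : b ∈ bandIdeal y α (m + 1) p) : y m ^ α p * b ∈ bandIdeal y α (m + 1) (p + 1) := by
  induction hb using Submodule.closure_induction with
  | zero => simp
  | add x z _ _ hx hz => rw [mul_add]; exact add_mem hx hz
  | smul_mem r x hx =>
    obtain ⟨c, rfl⟩ := hx
    rw [smul_eq_mul, mul_left_comm]
    refine Ideal.mul_mem_left _ _ (Ideal.subset_span ⟨Fin.snoc c (p + m), ?_⟩)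
    dsimp only
    rw [Matrix.det_succ_column _ (Fin.last p), Finset.sum_eq_single (Fin.last p)]
    · have h1 : bandEntry y α (m + 1) p (p + m) = y m ^ α p := by
        rw [bandEntry, if_pos (by omega)]
        simp
      have h2 : (-1 : A) ^ (p + p) = 1 := by rw [← two_mul, pow_mul]; simp
      simp only [Fin.val_last, Matrix.of_apply, Fin.snoc_last, h1, h2, one_mul]
      congr 2
      ext i j
      simp
    · intro i _ hi
      have hi' : (i : ℕ) < p := by
        have := Fin.val_lt_last hi
        simpa using this
      have h1 : bandEntry y α (m + 1) i (p + m) = 0 := by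
        rw [bandEntry, if_neg (by omega)]
      simp [h1]
    · simp

lemma bandIdeal_le (y : ℕ → A) (α : ℕ → ℕ) (m p : ℕ) (hα : ∀ i < p, α i ≠ 0) :
    bandIdeal y α m p ≤ bandIdeal y α (m + 1) p ⊔ Ideal.span {y m} := by
  rw [bandIdeal, Ideal.span_le]
  rintro _ ⟨c, rfl⟩
  set Q := bandIdeal y α (m + 1) p ⊔ Ideal.span {y m}
  have hy : Ideal.Quotient.mk Q (y m) = 0 := Ideal.Quotient.eq_zero_iff_mem.2
    (Ideal.mem_sup_right (Ideal.mem_span_singleton_self _))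
  have h1 : (Matrix.of fun i j : Fin p => bandEntry y α m i (c j)).map (Ideal.Quotient.mk Q) =
      (Matrix.of fun i j : Fin p => bandEntry y α (m + 1) i (c j)).map (Ideal.Quotient.mk Q) := by
    ext i j
    simp only [Matrix.map_apply, Matrix.of_apply, bandEntry]
    by_cases h : c j = i + m
    · rw [if_neg (by omega), if_pos (by omega), h, Nat.add_sub_cancel_left, map_pow, hy,
        zero_pow (hα i i.2), map_zero]
    · by_cases h' : (i : ℕ) ≤ c j ∧ c j < i + m
      · rw [if_pos h', if_pos (by omega)]
      · rw [if_neg h', if_neg (by omega)]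
  change _ ∈ Q
  rw [← Ideal.Quotient.eq_zero_iff_mem, RingHom.map_det, RingHom.mapMatrix_apply, h1,
    ← RingHom.mapMatrix_apply, ← RingHom.map_det, Ideal.Quotient.eq_zero_iff_mem]
  exact Ideal.mem_sup_left (Ideal.subset_span ⟨c, rfl⟩)

theorem codimLE_bandIdeal (y : ℕ → A) {α : ℕ → ℕ} (hα : Antitone α) (m p : ℕ) {J : Ideal A} {B : ℕ}
    (h : CodimLE k (J ⊔ Ideal.span (y '' Set.Iio m)) B) :
    CodimLE k (J ⊔ bandIdeal y α m p) (hrec α m p * B) := by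
  induction m generalizing p J with
  | zero =>
    rw [hrec, one_mul]
    refine h.mono ?_
    simp
  | succ m ihm =>
    induction p generalizing J with
    | zero =>
      rw [hrec, zero_mul]
      refine codimLE_top.mono ?_
      rw [top_le_iff, Ideal.eq_top_iff_one]
      exact Ideal.mem_sup_right (Ideal.subset_span ⟨Fin.elim0, by simp⟩)
    | succ p ihp =>
      rw [hrec, add_mul, mul_assoc]
      refine CodimLE.of_mul (x := y m ^ α p) (J' := J ⊔ bandIdeal y α (m + 1) p) ?_ (ihp h) ?_
      · by_cases h0 : α p = 0
        · rw [h0, zero_mul]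
          simpa using codimLE_top
        · refine CodimLE.pow ?_ _
          have h1 := ihm (p + 1) (J := J ⊔ Ideal.span {y m}) (h.mono ?_)
          · refine h1.mono ?_
            refine sup_le (sup_le_sup_right le_sup_left _) ?_
            refine (bandIdeal_le y α m (p + 1) fun i hi hi0 => h0 ?_).trans
              (sup_le_sup_right le_sup_right _)
            exact Nat.eq_zero_of_le_zero (hi0 ▸ hα (Nat.lt_succ_iff.1 hi))
          · refine sup_le (le_sup_left.trans le_sup_left) ?_
            rw [Ideal.span_le]
            rintro _ ⟨i, hi, rfl⟩
            rcases Nat.lt_succ_iff_lt_or_eq.1 hi with hi | rfl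
            · exact Ideal.mem_sup_right (Ideal.subset_span ⟨i, hi, rfl⟩)
            · exact Ideal.mem_sup_left (Ideal.mem_sup_right (Ideal.mem_span_singleton_self _))
      · intro b hb
        obtain ⟨j, hj, w, hw, rfl⟩ := Submodule.mem_sup.1 hb
        rw [mul_add]
        exact add_mem (Ideal.mem_sup_left (Ideal.mul_mem_left _ _ hj))
          (Ideal.mem_sup_right (mul_mem_bandIdeal y α m p hw))

end Codim

section SymmetricFunctions

lemma hsym_univ_eq_eval {ι : Type*} [Fintype ι] [DecidableEq ι] (m : ℕ) (f : ι → ℕ) :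
    hsym m univ f = eval f (hsymm ι ℕ m) := by
  rw [hsym, sym_univ, hsymm, map_sum]
  refine sum_congr rfl fun s _ => ?_
  rw [map_multiset_prod, Multiset.map_map]
  congr 1
  exact Multiset.map_congr rfl fun i _ => by simp

lemma hsym_comp_equiv {ι κ : Type*} [Fintype ι] [DecidableEq ι] [Fintype κ] [DecidableEq κ]
    (e : ι ≃ κ) (m : ℕ) (f : κ → ℕ) : hsym m univ (f ∘ e) = hsym m univ f := by
  rw [hsym_univ_eq_eval, hsym_univ_eq_eval, ← rename_hsymm ι ℕ m e, eval_rename]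

lemma hsym_option_succ {ι : Type*} [Fintype ι] [DecidableEq ι] (m : ℕ) (f : Option ι → ℕ) :
    hsym (m + 1) univ f = f none * hsym m univ f + hsym (m + 1) univ (f ∘ some) := by
  simp only [hsym, sym_univ]
  rw [← (symOptionSuccEquiv (α := ι) (n := m)).symm.sum_comp, Fintype.sum_sum_type, mul_sum]
  congr 1
  · refine sum_congr rfl fun s _ => ?_
    change (Multiset.map f (none ::ₘ (s : Multiset (Option ι)))).prod = _
    rw [Multiset.map_cons, Multiset.prod_cons]
  · refine sum_congr rfl fun s _ => ?_
    simp [symOptionSuccEquiv, Multiset.map_map]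

lemma hsym_eq_hrec (α : ℕ → ℕ) (m p : ℕ) :
    hsym m univ (fun i : Fin p => α i) = hrec α m p := by
  induction m generalizing p with
  | zero =>
    rw [hsym_univ_eq_eval, hsymm_zero, map_one, hrec]
  | succ m ihm =>
    induction p with
    | zero => simp [hsym, hrec]
    | succ p ihp =>
      rw [hrec, ← ihm, ← ihp, ← hsym_comp_equiv finSuccEquivLast.symm, hsym_option_succ,
        hsym_comp_equiv finSuccEquivLast.symm]
      simp [Function.comp_def]

end SymmetricFunctions

section Model
variable {k : Type*} [Field k]

lemma CodimLE.prod_pow {A ι : Type*} [CommRing A] [Algebra k A] [Fintype ι] {J : Ideal A} {B : ℕ}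
    (z : ι → A) (h : CodimLE k (J ⊔ Ideal.span (Set.range z)) B) (β : ι → ℕ) :
    CodimLE k (J ⊔ Ideal.span (Set.range fun i => z i ^ β i)) ((∏ i, β i) * B) := by
  classical
  have key : ∀ T : Finset ι, CodimLE k
      (J ⊔ Ideal.span (Set.range fun i => if i ∈ T then z i ^ β i else z i))
      ((∏ i ∈ T, β i) * B) := by
    intro T
    induction T using Finset.induction_on with
    | empty => simpa using h
    | insert a T ha ih =>
      rw [prod_insert ha, mul_assoc]
      set w : ι → A := fun i => if i ∈ T then z i ^ β i else z i with hw
      have h1 : CodimLE k ((J ⊔ Ideal.span (w '' {a}ᶜ)) ⊔ Ideal.span {z a})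
          ((∏ i ∈ T, β i) * B) := by
        refine ih.mono (sup_le (le_sup_left.trans le_sup_left) ?_)
        rw [Ideal.span_le]
        rintro _ ⟨i, rfl⟩
        by_cases hi : i = a
        · subst hi
          refine Ideal.mem_sup_right ?_
          simp only [hw, if_neg ha]
          exact Ideal.mem_span_singleton_self _
        · exact Ideal.mem_sup_left (Ideal.mem_sup_right (Ideal.subset_span ⟨i, hi, rfl⟩))
      refine (h1.pow (β a)).mono (sup_le (sup_le le_sup_left (le_sup_of_le_right ?_))
        (le_sup_of_le_right ?_))
      · rw [Ideal.span_le]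
        rintro _ ⟨i, hi, rfl⟩
        refine Ideal.subset_span ⟨i, ?_⟩
        have hi' : i ≠ a := hi
        simp [hw, hi']
      · rw [Ideal.span_le, Set.singleton_subset_iff]
        exact Ideal.subset_span ⟨a, by simp⟩
  simpa using key univ

lemma codimLE_span_X {σ : Type*} : CodimLE k (Ideal.span (Set.range (X : σ → MvPolynomial σ k))) 1 := by
  refine ⟨fun _ => 1, fun a => ⟨fun _ => constantCoeff a, ?_⟩⟩
  rw [← Set.image_univ, mem_ideal_span_X_image]
  intro μ hμ
  by_contra! hc
  have h0 : μ = 0 := Finsupp.ext fun i => hc i trivial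
  rw [mem_support_iff] at hμ
  apply hμ
  subst h0
  simp [constantCoeff_eq]

lemma minorIdeal_submatrix_le {R : Type*} [CommRing R] {p q : ℕ} (Z : Matrix (Fin p) (Fin q) R)
    (e : Equiv.Perm (Fin p)) : minorIdeal Z ≤ minorIdeal (Z.submatrix e id) := by
  rw [minorIdeal, Ideal.span_le]
  rintro _ ⟨c, rfl⟩
  have h1 : ((Z.submatrix e id).submatrix id c).det ∈ minorIdeal (Z.submatrix e id) :=
    Ideal.subset_span ⟨c, rfl⟩
  have h2 : ((Z.submatrix e id).submatrix id c).det =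
      ((Equiv.Perm.sign e : ℤ) : R) * (Z.submatrix id c).det := by
    rw [← Matrix.det_permute]
    rfl
  have h3 := Ideal.mul_mem_left _ (((Equiv.Perm.sign e : ℤˣ) : ℤ) : R) h1
  rw [h2, ← mul_assoc, ← Int.cast_mul, ← Units.val_mul, Int.units_mul_self] at h3
  simpa using h3

lemma bandIdeal_le_minorIdeal {A : Type*} [CommRing A] {p q m : ℕ} (hq : q + 1 = m + p)
    (y : ℕ → A) (α : ℕ → ℕ) :
    bandIdeal y α m p ≤
      minorIdeal (Matrix.of fun (i : Fin p) (j : Fin q) => bandEntry y α m i j) := by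
  rw [bandIdeal, Ideal.span_le]
  rintro _ ⟨c, rfl⟩
  by_cases hc : ∀ j, c j < q
  · by_cases hinj : Function.Injective c
    · refine Ideal.subset_span ⟨⟨fun j => ⟨c j, hc j⟩, fun i j hij => hinj ?_⟩, rfl⟩
      simpa using hij
    · obtain ⟨i, j, hij, hne⟩ := Function.not_injective_iff.1 hinj
      dsimp only
      rw [Matrix.det_zero_of_column_eq hne (fun l => by simp [hij])]
      exact zero_mem _
  · push Not at hc
    obtain ⟨j, hj⟩ := hc
    dsimp only
    rw [Matrix.det_eq_zero_of_column_eq_zero j]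
    · exact zero_mem _
    · intro i
      have := i.2
      exact if_neg (by omega)

/-- A homogeneous model with prescribed row degrees. -/
theorem exists_model {p q m s n : ℕ} (hq : q + 1 = m + p) (hn : n = m + s) (α : Fin p → ℕ)
    (β : Fin s → ℕ) :
    ∃ (H : Matrix (Fin p) (Fin q) (MvPolynomial (Fin n) k)) (h : Fin s → MvPolynomial (Fin n) k),
      (∀ i j, (H i j).IsHomogeneous (α i)) ∧ (∀ i, (h i).IsHomogeneous (β i)) ∧
      CodimLE k (minorIdeal H ⊔ Ideal.span (Set.range h)) ((∏ i, β i) * hsym m univ α) := by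
  subst hn
  let e : Equiv.Perm (Fin p) := Tuple.sort fun i => OrderDual.toDual (α i)
  have he : Antitone (α ∘ e) := Tuple.monotone_sort fun i => OrderDual.toDual (α i)
  let α' : ℕ → ℕ := fun i => if h : i < p then α (e ⟨i, h⟩) else 0
  have hα' : Antitone α' := by
    intro i j hij
    by_cases hj : j < p
    · have hi : i < p := hij.trans_lt hj
      simp only [α', dif_pos hi, dif_pos hj]
      exact he (show (⟨i, hi⟩ : Fin p) ≤ ⟨j, hj⟩ from hij)
    · simp [α', hj]
  let y : ℕ → MvPolynomial (Fin (m + s)) k := fun r => if h : r < m + s then X ⟨r, h⟩ else 0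
  let H₀ : Matrix (Fin p) (Fin q) (MvPolynomial (Fin (m + s)) k) :=
    Matrix.of fun i j => bandEntry y α' m i j
  have hy : ∀ r, (y r).IsHomogeneous 1 := by
    intro r
    by_cases hr : r < m + s
    · simp only [y, dif_pos hr]; exact isHomogeneous_X _ _
    · simp only [y, dif_neg hr]; exact isHomogeneous_zero _ _ _
  refine ⟨H₀.submatrix e.symm id, fun i => X (Fin.natAdd m i) ^ β i, ?_, ?_, ?_⟩
  · intro i j
    have h1 : α' (e.symm i) = α i := by simp [α']
    simp only [H₀, Matrix.submatrix_apply, Matrix.of_apply, bandEntry, h1]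
    split_ifs
    · simpa using (hy _).pow (α i)
    · exact isHomogeneous_zero _ _ _
  · intro i
    simpa using (isHomogeneous_X k (Fin.natAdd m i)).pow (β i)
  · have h1 : CodimLE k ((Ideal.span (y '' Set.Iio m)) ⊔
        Ideal.span (Set.range fun i : Fin s => (X (Fin.natAdd m i) : MvPolynomial _ k))) 1 := by
      refine codimLE_span_X.mono ?_
      rw [Ideal.span_le]
      rintro _ ⟨i, rfl⟩
      induction i using Fin.addCases with
      | left i =>
        refine Ideal.mem_sup_left (Ideal.subset_span ⟨i, i.2, ?_⟩)
        simp only [y]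
        rw [dif_pos (by omega)]
        rfl
      | right i => exact Ideal.mem_sup_right (Ideal.subset_span ⟨i, rfl⟩)
    have h2 := h1.prod_pow _ β
    rw [mul_one, sup_comm] at h2
    have h3 := codimLE_bandIdeal y hα' m p h2
    rw [← hsym_eq_hrec, mul_comm] at h3
    have h4 : (fun i : Fin p => α' i) = α ∘ e := by ext i; simp [α']
    rw [h4, hsym_comp_equiv] at h3
    refine h3.mono ?_
    rw [sup_comm]
    exact sup_le_sup_right ((bandIdeal_le_minorIdeal hq y α').trans
      (minorIdeal_submatrix_le _ _)) _

end Model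

section Multiplicity
variable {k : Type*} [Field k]

lemma CodimLE.exists_span_eq_top {A : Type*} [CommRing A] [Algebra k A] {J : Ideal A} {B : ℕ}
    (h : CodimLE k J B) :
    ∃ v : Fin B → A, Submodule.span k (Set.range fun i => Ideal.Quotient.mk J (v i)) = ⊤ := by
  obtain ⟨v, hv⟩ := h
  refine ⟨v, ?_⟩
  rw [eq_top_iff]
  intro x _
  obtain ⟨a, rfl⟩ := Ideal.Quotient.mk_surjective x
  obtain ⟨u, hu⟩ := hv a
  rw [← Ideal.Quotient.mk_eq_mk_iff_sub_mem] at hu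
  rw [hu, map_sum]
  refine sum_mem fun i _ => ?_
  have : Ideal.Quotient.mk J (u i • v i) = u i • Ideal.Quotient.mk J (v i) := rfl
  rw [this]
  exact Submodule.smul_mem _ _ (Submodule.subset_span ⟨i, rfl⟩)

lemma CodimLE.finite {A : Type*} [CommRing A] [Algebra k A] {J : Ideal A} {B : ℕ}
    (h : CodimLE k J B) : Module.Finite k (A ⧸ J) := by
  obtain ⟨v, hv⟩ := h.exists_span_eq_top
  exact Module.finite_def.2 (hv ▸ Submodule.fg_span (Set.finite_range _))

lemma CodimLE.finrank_le {A : Type*} [CommRing A] [Algebra k A] {J : Ideal A} {B : ℕ}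
    (h : CodimLE k J B) : Module.finrank k (A ⧸ J) ≤ B := by
  obtain ⟨v, hv⟩ := h.exists_span_eq_top
  have := finrank_range_le_card (R := k) fun i => Ideal.Quotient.mk J (v i)
  rwa [Set.finrank, hv, finrank_top, Fintype.card_fin] at this

lemma mem_span_X_pow {σ : Type*} (M : ℕ) (T : Finset σ) (f : MvPowerSeries σ k)
    (hf : ∀ μ : σ →₀ ℕ, (∀ i ∈ T, μ i < M) → MvPowerSeries.coeff μ f = 0) :
    f ∈ Ideal.span ((fun i => (MvPowerSeries.X i : MvPowerSeries σ k) ^ M) '' T) := by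
  classical
  induction T using Finset.induction_on generalizing f with
  | empty =>
    have : f = 0 := MvPowerSeries.ext fun μ => by simpa using hf μ (by simp)
    simp [this]
  | insert a T ha ih =>
    let f₁ : MvPowerSeries σ k := fun μ => if μ a < M then MvPowerSeries.coeff μ f else 0
    have hf₁ : ∀ μ, MvPowerSeries.coeff μ f₁ = if μ a < M then MvPowerSeries.coeff μ f else 0 :=
      fun _ => rfl
    rw [← sub_add_cancel f f₁]
    refine add_mem ?_ ?_
    · have h1 : (MvPowerSeries.X a : MvPowerSeries σ k) ^ M ∣ f - f₁ := by
        rw [MvPowerSeries.X_pow_dvd_iff]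
        intro μ hμ
        rw [map_sub, hf₁, if_pos hμ, sub_self]
      exact Ideal.mem_of_dvd _ h1 (Ideal.subset_span ⟨a, by simp, rfl⟩)
    · refine Ideal.span_mono (Set.image_mono (by simp)) (ih f₁ fun μ hμ => ?_)
      rw [hf₁]
      split_ifs with h
      · refine hf μ fun i hi => ?_
        rcases Finset.mem_insert.1 hi with rfl | hi
        · exact h
        · exact hμ i hi
      · rfl

variable {n : ℕ}

/-- The ideal generated by the `M`-th powers of the coordinates centred at `ξ`. -/
noncomputable def boxIdeal (ξ : Fin n → k) (M : ℕ) : Ideal (MvPolynomial (Fin n) k) :=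
  Ideal.span (Set.range fun i => (X i - C (ξ i)) ^ M)

lemma codimLE_boxIdeal (ξ : Fin n → k) (M : ℕ) : ∃ B, CodimLE k (boxIdeal ξ M) B := by
  have h1 : CodimLE k (Ideal.span (Set.range fun i : Fin n =>
      (X i - C (ξ i) : MvPolynomial (Fin n) k))) 1 := by
    obtain ⟨v, hv⟩ := codimLE_span_X (k := k) (σ := Fin n)
    refine ⟨fun i => (translate ξ).symm (v i), fun a => ?_⟩
    obtain ⟨u, hu⟩ := hv (translate ξ a)
    refine ⟨u, ?_⟩
    have h2 := Ideal.mem_map_of_mem (translate ξ).symm hu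
    rw [Ideal.map_span, ← Set.range_comp] at h2
    have h3 : ((translate ξ).symm ∘ X : Fin n → MvPolynomial (Fin n) k) =
        fun i => X i - C (ξ i) := by
      ext1 i
      simp [translate]
    rw [h3] at h2
    simpa using h2
  have h2 := CodimLE.prod_pow (J := ⊥) (fun i : Fin n => (X i - C (ξ i) : MvPolynomial (Fin n) k))
    (by rw [bot_sup_eq]; exact h1) fun _ => M
  rw [bot_sup_eq] at h2
  exact ⟨_, h2⟩

lemma isCoprime_boxIdeal {ξ η : Fin n → k} (h : ξ ≠ η) (M N : ℕ) :
    IsCoprime (boxIdeal ξ M) (boxIdeal η N) := by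
  obtain ⟨i, hi⟩ := Function.ne_iff.1 h
  have h1 : IsCoprime (X i - C (ξ i) : MvPolynomial (Fin n) k) (X i - C (η i)) := by
    refine ⟨C (η i - ξ i)⁻¹, - C (η i - ξ i)⁻¹, ?_⟩
    have h2 : (C (η i - ξ i)⁻¹ * C (η i - ξ i) : MvPolynomial (Fin n) k) = 1 := by
      rw [← C_mul, inv_mul_cancel₀ (sub_ne_zero.2 hi.symm), C_1]
    rw [← h2, C_sub]
    ring
  obtain ⟨a, b, hab⟩ := h1.pow (m := M) (n := N)
  rw [Ideal.isCoprime_iff_exists]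
  exact ⟨_, Ideal.mul_mem_left _ a (Ideal.subset_span ⟨i, rfl⟩), _,
    Ideal.mul_mem_left _ b (Ideal.subset_span ⟨i, rfl⟩), hab⟩

lemma coeff_zero_translate (ξ : Fin n → k) (h : MvPolynomial (Fin n) k) :
    coeff 0 (translate ξ h) = eval ξ h := by
  have h1 : (constantCoeff.comp (translate ξ).toRingEquiv.toRingHom) = eval ξ := by
    ext <;> simp [translate]
  exact RingHom.congr_fun h1 h

lemma mem_of_mul_mem_of_boxIdeal_le {Q : Ideal (MvPolynomial (Fin n) k)} {ξ : Fin n → k} {M : ℕ}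
    (hQ : boxIdeal ξ M ≤ Q) {h f : MvPolynomial (Fin n) k} (hξ : eval ξ h ≠ 0) (hf : h * f ∈ Q) :
    f ∈ Q := by
  have h1 : h - C (eval ξ h) ∈ Q.radical := by
    have h2 : Ideal.span (Set.range fun i : Fin n => (X i - C (ξ i) : MvPolynomial (Fin n) k)) ≤
        Q.radical := by
      rw [Ideal.span_le]
      rintro _ ⟨i, rfl⟩
      exact ⟨M, hQ (Ideal.subset_span ⟨i, rfl⟩)⟩
    refine h2 ?_
    have h3 : translate ξ h - C (eval ξ h) ∈
        Ideal.span (Set.range (X : Fin n → MvPolynomial (Fin n) k)) := by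
      rw [← Set.image_univ, mem_ideal_span_X_image]
      intro μ hμ
      by_contra! hc
      have h0 : μ = 0 := Finsupp.ext fun i => hc i trivial
      rw [mem_support_iff] at hμ
      apply hμ
      subst h0
      rw [coeff_sub, coeff_zero_C, sub_eq_zero]
      exact coeff_zero_translate ξ h
    have h6 := Ideal.mem_map_of_mem (translate ξ).symm h3
    rw [Ideal.map_span, ← Set.range_comp] at h6
    have h7 : ((translate ξ).symm ∘ X : Fin n → MvPolynomial (Fin n) k) =
        fun i => X i - C (ξ i) := by
      ext1 i
      simp [translate]
    rw [h7, map_sub, AlgEquiv.symm_apply_apply] at h6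
    convert h6 using 2
    exact ((translate ξ).symm.commutes _).symm
  obtain ⟨N, hN⟩ := h1
  have hu : IsUnit (Ideal.Quotient.mk Q h) := by
    have h8 : IsNilpotent (Ideal.Quotient.mk Q (h - C (eval ξ h))) :=
      ⟨N, by rw [← map_pow]; exact Ideal.Quotient.eq_zero_iff_mem.2 hN⟩
    have h9 : IsUnit (Ideal.Quotient.mk Q (C (eval ξ h))) :=
      (hξ.isUnit.map C).map _
    have := h8.isUnit_add_left_of_commute h9 (Commute.all _ _)
    rwa [← map_add, add_sub_cancel] at this
  rw [← Ideal.Quotient.eq_zero_iff_mem, map_mul] at hf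
  exact Ideal.Quotient.eq_zero_iff_mem.1 ((hu.mul_right_eq_zero).1 hf)

/-- The multiplicity at an isolated zero is computed in a finite-dimensional quotient of the
polynomial ring. -/
theorem exists_multAt_le {I : Ideal (MvPolynomial (Fin n) k)} {ξ : Fin n → k}
    {h : MvPolynomial (Fin n) k} (hξ : eval ξ h ≠ 0)
    (hrad : ∀ i, h * (X i - C (ξ i)) ∈ I.radical) :
    ∃ M, multAt I ξ ≤ Module.finrank k (MvPolynomial (Fin n) k ⧸ I ⊔ boxIdeal ξ M) := by
  choose e he using hrad
  let M := ∑ i, e i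
  refine ⟨M, ?_⟩
  let φ : MvPolynomial (Fin n) k →+* MvPowerSeries (Fin n) k :=
    (MvPolynomial.coeToMvPowerSeries.ringHom).comp
      ((MvPolynomial.aeval (fun v => MvPolynomial.X v + MvPolynomial.C (ξ v)) :
          MvPolynomial (Fin n) k →ₐ[k] MvPolynomial (Fin n) k)).toRingHom
  have hφ : ∀ f, φ f = ((translate ξ f : MvPolynomial (Fin n) k) : MvPowerSeries (Fin n) k) :=
    fun _ => rfl
  set I' := I.map φ with hI'
  have hu : IsUnit (φ h) := by
    rw [MvPowerSeries.isUnit_iff_constantCoeff]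
    have h6 : MvPowerSeries.constantCoeff (φ h) = eval ξ h := by
      rw [hφ, ← coeff_zero_translate, ← MvPowerSeries.coeff_zero_eq_constantCoeff_apply, coeff_coe]
    rw [h6]
    exact hξ.isUnit
  have hφX : ∀ i, φ (X i - C (ξ i)) = MvPowerSeries.X i := by
    intro i
    rw [hφ]
    simp [translate]
  have hX : ∀ i, (MvPowerSeries.X i : MvPowerSeries (Fin n) k) ^ M ∈ I' := by
    intro i
    have h1 : (h * (X i - C (ξ i))) ^ M ∈ I :=
      Ideal.pow_mem_of_pow_mem _ (he i)
        (single_le_sum (f := e) (fun _ _ => Nat.zero_le _) (mem_univ i))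
    have h2 := Ideal.mem_map_of_mem φ h1
    rw [map_pow, map_mul, hφX, mul_pow] at h2
    exact (Ideal.unit_mul_mem_iff_mem _ (hu.pow M)).1 h2
  let ψ : MvPolynomial (Fin n) k →ₐ[k] MvPowerSeries (Fin n) k ⧸ I' :=
    { toRingHom := (Ideal.Quotient.mk I').comp φ
      commutes' := by
        intro r
        change Ideal.Quotient.mk I' (φ (C r)) = _
        rw [hφ]
        have : translate ξ (C r) = C r := (translate ξ).commutes r
        rw [this, coe_C]
        rfl }
  have hψ : ∀ f, ψ f = Ideal.Quotient.mk I' (φ f) := fun _ => rfl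
  have hker : ∀ f ∈ I ⊔ boxIdeal ξ M, ψ f = 0 := by
    have : I ⊔ boxIdeal ξ M ≤ I'.comap φ := by
      refine sup_le Ideal.le_comap_map ?_
      rw [boxIdeal, Ideal.span_le]
      rintro _ ⟨i, rfl⟩
      change φ ((X i - C (ξ i)) ^ M) ∈ I'
      rw [map_pow, hφX]
      exact hX i
    intro f hf
    rw [hψ, Ideal.Quotient.eq_zero_iff_mem]
    exact this hf
  let Ψ : (MvPolynomial (Fin n) k ⧸ I ⊔ boxIdeal ξ M) →ₐ[k] MvPowerSeries (Fin n) k ⧸ I' :=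
    Ideal.Quotient.liftₐ _ ψ hker
  have hsurj : Function.Surjective Ψ.toLinearMap := by
    intro y
    obtain ⟨f, rfl⟩ := Ideal.Quotient.mk_surjective y
    let f' := MvPowerSeries.truncTotal (n * M + 1) f
    refine ⟨Ideal.Quotient.mk _ ((translate ξ).symm f'), ?_⟩
    change ψ ((translate ξ).symm f') = _
    rw [hψ, hφ, AlgEquiv.apply_symm_apply, Ideal.Quotient.mk_eq_mk_iff_sub_mem]
    rw [← neg_mem_iff, neg_sub]
    have h1 := mem_span_X_pow M univ (f - (f' : MvPowerSeries (Fin n) k)) (by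
      intro μ hμ
      have hd : μ.degree < n * M + 1 := by
        rw [Finsupp.degree_eq_sum]
        have := sum_le_card_nsmul univ (fun i => μ i) M fun i hi => (hμ i hi).le
        simp only [card_univ, Fintype.card_fin, smul_eq_mul] at this
        omega
      rw [map_sub, coeff_coe, MvPowerSeries.coeff_truncTotal _ hd, sub_self])
    refine (Ideal.span_le.2 ?_) h1
    rintro _ ⟨i, -, rfl⟩
    exact hX i
  obtain ⟨B, hB⟩ := codimLE_boxIdeal ξ M
  have := (hB.mono (le_sup_right (a := I))).finite
  exact LinearMap.finrank_le_finrank_of_surjective hsurj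

lemma exists_independent_mod_iInf {A ι : Type*} [CommRing A] [Algebra k A] [Fintype ι]
    {Q : ι → Ideal A} (hQ : Pairwise (Function.onFun IsCoprime Q))
    [∀ i, Module.Finite k (A ⧸ Q i)] :
    ∃ v : Fin (∑ i, Module.finrank k (A ⧸ Q i)) → A,
      ∀ u : Fin (∑ i, Module.finrank k (A ⧸ Q i)) → k,
        (∀ i, ∑ j, u j • v j ∈ Q i) → u = 0 := by
  let b : Module.Basis (Fin (∑ i, Module.finrank k (A ⧸ Q i))) k (∀ i, A ⧸ Q i) :=
    Module.finBasisOfFinrankEq k _ (Module.finrank_pi_fintype k)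
  have hsurj := Ideal.pi_quotient_surjective hQ
  choose v hv using fun j => hsurj (b j)
  refine ⟨v, fun u hu => ?_⟩
  have h1 : ∑ j, u j • b j = 0 := by
    funext i
    have h2 := Ideal.Quotient.eq_zero_iff_mem.2 (hu i)
    rw [map_sum] at h2
    rw [Finset.sum_apply, Pi.zero_apply, ← h2]
    refine sum_congr rfl fun j _ => ?_
    rw [Pi.smul_apply, ← hv j i]
    rfl
  have h3 := Fintype.linearIndependent_iff.1 b.linearIndependent u h1
  exact funext h3

end Multiplicity

section RowDegree
variable {σ R : Type*} [CommRing R] {p : ℕ}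

lemma totalDegree_map_le {S : Type*} [CommRing S] (φ : R →+* S) (f : MvPolynomial σ R) :
    (MvPolynomial.map φ f).totalDegree ≤ f.totalDegree :=
  Finset.sup_mono (support_map_subset φ f)

lemma isHomogeneous_det {M : Matrix (Fin p) (Fin p) (MvPolynomial σ R)} {α : Fin p → ℕ}
    (hM : ∀ i j, (M i j).IsHomogeneous (α i)) : M.det.IsHomogeneous (∑ i, α i) := by
  rw [Matrix.det_apply']
  refine IsHomogeneous.sum _ _ _ fun τ _ => ?_
  have h1 : (((Equiv.Perm.sign τ : ℤˣ) : ℤ) : MvPolynomial σ R) =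
      C (((Equiv.Perm.sign τ : ℤˣ) : ℤ) : R) := by simp
  rw [h1, ← Equiv.sum_comp τ α]
  exact (IsHomogeneous.prod _ _ _ fun i _ => hM _ _).C_mul _

lemma totalDegree_det_le {M : Matrix (Fin p) (Fin p) (MvPolynomial σ R)} {α : Fin p → ℕ}
    (hM : ∀ i j, (M i j).totalDegree ≤ α i) : M.det.totalDegree ≤ ∑ i, α i := by
  rw [Matrix.det_apply']
  refine totalDegree_finsetSum_le fun τ _ => ?_
  have h1 : (((Equiv.Perm.sign τ : ℤˣ) : ℤ) : MvPolynomial σ R) =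
      C (((Equiv.Perm.sign τ : ℤˣ) : ℤ) : R) := by simp
  rw [h1, ← Equiv.sum_comp τ α]
  refine (totalDegree_mul _ _).trans ?_
  rw [totalDegree_C, zero_add]
  exact (totalDegree_finsetProd _ _).trans (sum_le_sum fun i _ => hM _ _)

end RowDegree

section Specialization
variable {k : Type*} [Field k]

lemma forall_eq_zero_of_eval_eq_zero {M : Type*} [AddCommGroup M] [Module (Polynomial k) M]
    (N : Submodule (Polynomial k) M) (c : k)
    (hN : ∀ b, (Polynomial.X - Polynomial.C c) • b ∈ N → b ∈ N) {r : ℕ} (v : Fin r → M)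
    (hv : ∀ u : Fin r → Polynomial k, ∑ i, u i • v i ∈ N → ∀ i, (u i).eval c = 0)
    (u : Fin r → Polynomial k) (hu : ∑ i, u i • v i ∈ N) : u = 0 := by
  have key : ∀ e : ℕ, ∀ u : Fin r → Polynomial k, ∑ i, u i • v i ∈ N →
      ∀ i, (Polynomial.X - Polynomial.C c) ^ e ∣ u i := by
    intro e
    induction e with
    | zero => intro u _ i; simp
    | succ e ih =>
      intro u hu i
      have h1 : ∀ i, (Polynomial.X - Polynomial.C c) ∣ u i := fun i =>
        Polynomial.dvd_iff_isRoot.2 (hv u hu i)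
      choose u' hu' using h1
      have h2 : ∑ i, u i • v i = (Polynomial.X - Polynomial.C c) • ∑ i, u' i • v i := by
        rw [smul_sum]
        exact sum_congr rfl fun i _ => by rw [smul_smul, ← hu']
      rw [h2] at hu
      rw [hu' i, pow_succ']
      exact mul_dvd_mul_left _ (ih u' (hN _ hu) i)
  funext i
  by_contra hne
  have h1 := Polynomial.natDegree_le_of_dvd (key ((u i).natDegree + 1) u hu i) hne
  rw [(Polynomial.monic_X_sub_C c).natDegree_pow, Polynomial.natDegree_X_sub_C] at h1
  omega

variable {n : ℕ}

lemma constFam_mem_degLT {f : MvPolynomial (Fin n) k} {d : ℕ} (hf : f ∈ degLT (Fin n) k d) :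
    constFam n k f ∈ degLT (Fin n) (Polynomial k) d :=
  mem_degLT.2 fun _ hμ => hf (support_map_subset _ _ hμ)

lemma homogeneousComponent_mul_of_lt {σ S : Type*} [CommRing S] {a e : ℕ} (h : e < a)
    (f : MvPolynomial σ S) {g : MvPolynomial σ S} (hg : g.IsHomogeneous a) :
    homogeneousComponent e (f * g) = 0 := by
  conv_lhs => rw [← sum_homogeneousComponent f]
  rw [Finset.sum_mul, map_sum]
  refine sum_eq_zero fun i _ => ?_
  rw [homogeneousComponent_of_mem
    (((homogeneousComponent_isHomogeneous i f).mul hg) : _ ∈ homogeneousSubmodule σ S (i + a)),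
    if_neg (by omega)]

/-- Elements of an ideal with homogeneous generators lift to a deformation without raising the
degree, as soon as the generators do. -/
lemma exists_lift {I : Ideal (MvPolynomial (Fin n) (Polynomial k))} {c : k}
    {G : Set (MvPolynomial (Fin n) k)}
    (hG : ∀ x ∈ G, ∃ a, x.IsHomogeneous a ∧ ∃ x' ∈ I, x'.totalDegree ≤ a ∧ spec n c x' = x)
    {f : MvPolynomial (Fin n) k} (hf : f ∈ Ideal.span G) {d : ℕ} (hd : f ∈ degLT (Fin n) k d) :
    ∃ f' ∈ I, f' ∈ degLT (Fin n) (Polynomial k) d ∧ spec n c f' = f := by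
  have key : ∀ e, ∃ f' ∈ I, f' ∈ degLT (Fin n) (Polynomial k) (e + 1) ∧
      spec n c f' = homogeneousComponent e f := by
    intro e
    clear hd
    induction hf using Submodule.closure_induction with
    | zero => exact ⟨0, zero_mem _, zero_mem _, by simp⟩
    | add x y _ _ hx hy =>
      obtain ⟨x', h1, h2, h3⟩ := hx
      obtain ⟨y', h4, h5, h6⟩ := hy
      exact ⟨x' + y', add_mem h1 h4, add_mem h2 h5, by rw [map_add, map_add, h3, h6]⟩
    | smul_mem r x hx =>
      obtain ⟨a, ha, x', h1, h2, h3⟩ := hG x hx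
      rw [smul_eq_mul]
      rcases lt_or_ge e a with hea | hea
      · refine ⟨0, zero_mem _, zero_mem _, ?_⟩
        rw [homogeneousComponent_mul_of_lt hea _ ha, map_zero]
      · obtain ⟨e', rfl⟩ := Nat.exists_eq_add_of_le' hea
        refine ⟨constFam n k (homogeneousComponent e' r) * x', Ideal.mul_mem_left _ _ h1, ?_, ?_⟩
        · have h4 := mul_mem_degLT (constFam_mem_degLT 
            (homogeneousComponent_mem_degLT (d := e') r)) h2
          rwa [show e' + a + 1 = e' + 1 + a by omega]
        · rw [map_mul, spec_constFam, h3, homogeneousComponent_mul_of_isHomogeneous _ ha]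
  choose F h1 h2 h3 using key
  refine ⟨∑ e ∈ range (f.totalDegree + 1), if e < d then F e else 0, ?_, ?_, ?_⟩
  · refine sum_mem fun e _ => ?_
    split_ifs
    exacts [h1 e, zero_mem _]
  · refine sum_mem fun e _ => ?_
    split_ifs with he
    exacts [degLT_mono he (h2 e), zero_mem _]
  · rw [map_sum]
    conv_rhs => rw [← sum_homogeneousComponent f]
    refine sum_congr rfl fun e _ => ?_
    split_ifs with he
    · exact h3 e
    · rw [map_zero, homogeneousComponent_eq_zero']
      intro μ hμ
      have : μ.degree < d := hd hμ
      omega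

lemma finite_setOf_degree_lt (n d : ℕ) : Finite {e : Fin n →₀ ℕ | e.degree < d} :=
  (Finsupp.finite_of_degree_lt d).to_subtype

instance (S : Type*) [CommRing S] (d : ℕ) : Module.Finite S (degLT (Fin n) S d) :=
  have := finite_setOf_degree_lt n d
  Module.Finite.of_basis (basisRestrictSupport S _)

lemma finrank_degLT (S : Type*) [CommRing S] [Nontrivial S] (d : ℕ) :
    Module.finrank S (degLT (Fin n) S d) = Nat.card {e : Fin n →₀ ℕ | e.degree < d} :=
  Module.finrank_eq_nat_card_basis (basisRestrictSupport S _)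

lemma spec_smul (c : k) (u : Polynomial k) (f : MvPolynomial (Fin n) (Polynomial k)) :
    spec n c (u • f) = u.eval c • spec n c f := by
  rw [smul_eq_C_mul, smul_eq_C_mul, map_mul, spec, map_C]
  rfl

lemma exists_independent_in_ker {V W : Type*} [AddCommGroup V] [Module k V] [AddCommGroup W]
    [Module k W] [Module.Finite k V] [Module.Finite k W] (π : V →ₗ[k] W) :
    ∃ (r : ℕ) (w : Fin r → V), LinearIndependent k w ∧ (∀ i, π (w i) = 0) ∧
      Module.finrank k V ≤ r + Module.finrank k W := by
  let w := Module.finBasis k (LinearMap.ker π)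
  refine ⟨_, fun i => (w i : V), w.linearIndependent.map' _ (Submodule.ker_subtype _),
    fun i => LinearMap.mem_ker.1 (w i).2, ?_⟩
  have h1 := π.finrank_range_add_finrank_ker
  have h2 := Submodule.finrank_le (LinearMap.range π)
  omega

/-- A family independent modulo a deformation is no longer than the codimension of a fibre with
homogeneous generators. -/
theorem le_of_independent_mod {I : Ideal (MvPolynomial (Fin n) (Polynomial k))} {c : k}
    {G : Set (MvPolynomial (Fin n) k)}
    (hG : ∀ x ∈ G, ∃ a, x.IsHomogeneous a ∧ ∃ x' ∈ I, x'.totalDegree ≤ a ∧ spec n c x' = x)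
    {B : ℕ} (hB : CodimLE k (Ideal.span G) B) {D : ℕ} (v : Fin D → MvPolynomial (Fin n) k)
    (hv : ∀ u : Fin D → Polynomial k, ∑ j, u j • constFam n k (v j) ∈ I → u = 0) : D ≤ B := by
  let d := univ.sup (fun j => (v j).totalDegree) + 1
  have hvd : ∀ j, v j ∈ degLT (Fin n) k d := fun j =>
    mem_degLT_of_totalDegree_lt
      (Nat.lt_succ_of_le (le_sup (f := fun j => (v j).totalDegree) (mem_univ j)))
  let π : degLT (Fin n) k d →ₗ[k] MvPolynomial (Fin n) k ⧸ Ideal.span G :=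
    (Ideal.Quotient.mkₐ k (Ideal.span G)).toLinearMap ∘ₗ (degLT (Fin n) k d).subtype
  have hfin := hB.finite
  obtain ⟨r, w, hwi, hwk, hwr⟩ := exists_independent_in_ker π
  have hw : ∀ i, ((w i : degLT (Fin n) k d) : MvPolynomial (Fin n) k) ∈ Ideal.span G := fun i =>
    Ideal.Quotient.eq_zero_iff_mem.1 (hwk i)
  choose w' h1 h2 h3 using fun i => exists_lift hG (hw i) (w i).2
  have hw' : ∀ u : Fin r → Polynomial k,
      ∑ i, u i • w' i = 0 → u = 0 := by
    intro u hu
    refine forall_eq_zero_of_eval_eq_zero (⊥ : Submodule (Polynomial k) _) c ?_ w' ?_ u (by simp [hu])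
    · intro b hb
      rw [Submodule.mem_bot, smul_eq_C_mul, mul_eq_zero] at hb
      refine (Submodule.mem_bot _).2 (hb.resolve_left ?_)
      exact fun h => Polynomial.X_sub_C_ne_zero c ((C_eq_zero).1 h)
    · intro u hu
      have h4 := congrArg (spec n c) ((Submodule.mem_bot _).1 hu)
      rw [map_sum, map_zero] at h4
      simp only [spec_smul, h3] at h4
      refine Fintype.linearIndependent_iff.1 hwi _ ?_
      apply Subtype.ext
      rw [← Submodule.subtype_apply, map_sum]
      exact h4
  let z : Fin r ⊕ Fin D → degLT (Fin n) (Polynomial k) d :=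
    Sum.elim (fun i => ⟨w' i, h2 i⟩) fun j => ⟨constFam n k (v j), constFam_mem_degLT (hvd j)⟩
  have hz : LinearIndependent (Polynomial k) z := by
    rw [Fintype.linearIndependent_iff]
    intro u hu
    have h4 := congrArg (Submodule.subtype _) hu
    rw [map_sum, map_zero, Fintype.sum_sum_type] at h4
    simp only [map_smul, Submodule.subtype_apply, z, Sum.elim_inl, Sum.elim_inr] at h4
    have h5 : (fun j => u (Sum.inr j)) = 0 := by
      apply hv
      rw [add_comm, add_eq_zero_iff_eq_neg] at h4
      rw [h4]
      refine neg_mem (sum_mem fun i _ => ?_)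
      rw [smul_eq_C_mul]
      exact Ideal.mul_mem_left _ _ (h1 i)
    have h6 : (fun i => u (Sum.inl i)) = 0 := by
      apply hw'
      have h7 : ∀ j, u (Sum.inr j) = 0 := congrFun h5
      simpa [h7] using h4
    rintro (i | j)
    exacts [congrFun h6 i, congrFun h5 j]
  have hcard := hz.fintype_card_le_finrank
  rw [finrank_degLT, Fintype.card_sum, Fintype.card_fin, Fintype.card_fin] at hcard
  rw [finrank_degLT] at hwr
  have := hB.finrank_le
  omega

end Specialization

section Main
variable {k : Type*} [Field k] {n : ℕ}

/-- The linear pencil joining `f` at parameter `0` to `f'` at parameter `1`. -/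
noncomputable def pencil (f f' : MvPolynomial (Fin n) k) : MvPolynomial (Fin n) (Polynomial k) :=
  C (1 - Polynomial.X) * constFam n k f + C Polynomial.X * constFam n k f'

lemma spec_zero_pencil (f f' : MvPolynomial (Fin n) k) : spec n 0 (pencil f f') = f := by
  rw [pencil, map_add, map_mul, map_mul, spec_constFam, spec_constFam]
  simp

lemma spec_one_pencil (f f' : MvPolynomial (Fin n) k) : spec n 1 (pencil f f') = f' := by
  rw [pencil, map_add, map_mul, map_mul, spec_constFam, spec_constFam]
  simp

lemma totalDegree_pencil_le {f f' : MvPolynomial (Fin n) k} {d : ℕ} (hf : f.totalDegree ≤ d)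
    (hf' : f'.totalDegree ≤ d) : (pencil f f').totalDegree ≤ d := by
  refine (totalDegree_add _ _).trans (max_le ?_ ?_)
  · refine (totalDegree_mul _ _).trans ?_
    rw [totalDegree_C, zero_add]
    exact (totalDegree_map_le _ _).trans hf
  · refine (totalDegree_mul _ _).trans ?_
    rw [totalDegree_C, zero_add]
    exact (totalDegree_map_le _ _).trans hf'

variable [IsAlgClosed k] {p q m s : ℕ}

/-- Independence modulo the local components of the special fibre spreads out to independence
modulo the whole deformation. -/
theorem independent_of_special_fibre (hp : 1 ≤ p) (hq : q + 1 = m + p) (hn : n = m + s)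
    (F : Matrix (Fin p) (Fin q) (MvPolynomial (Fin n) (Polynomial k)))
    (g : Fin s → MvPolynomial (Fin n) (Polynomial k)) {I : Ideal (MvPolynomial (Fin n) k)}
    (hI : (minorIdeal F ⊔ Ideal.span (Set.range g)).map (spec n 0) = I)
    {pts : Finset (Fin n → k)} (hpts : ∀ x ∈ pts, IsIsolatedZero I x) (M : pts → ℕ) {D : ℕ}
    (v : Fin D → MvPolynomial (Fin n) k)
    (hv : ∀ u : Fin D → k, (∀ x : pts, ∑ j, u j • v j ∈ I ⊔ boxIdeal (x : Fin n → k) (M x)) → u = 0)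
    (u : Fin D → Polynomial k)
    (hu : ∑ j, u j • constFam n k (v j) ∈ minorIdeal F ⊔ Ideal.span (Set.range g)) : u = 0 := by
  set J := minorIdeal F ⊔ Ideal.span (Set.range g) with hJ
  let N : Submodule (Polynomial k) (MvPolynomial (Fin n) (Polynomial k)) :=
    { carrier := {b | ∃ e : ℕ, C Polynomial.X ^ e * b ∈ J}
      zero_mem' := ⟨0, by simp⟩
      add_mem' := by
        rintro a b ⟨e, he⟩ ⟨e', he'⟩
        refine ⟨e + e', ?_⟩
        have h1 := add_mem (Ideal.mul_mem_left J (C Polynomial.X ^ e') he)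
          (Ideal.mul_mem_left J (C Polynomial.X ^ e) he')
        rwa [show C Polynomial.X ^ e' * (C Polynomial.X ^ e * a) +
          C Polynomial.X ^ e * (C Polynomial.X ^ e' * b) =
            C Polynomial.X ^ (e + e') * (a + b) by ring] at h1
      smul_mem' := by
        rintro r b ⟨e, he⟩
        refine ⟨e, ?_⟩
        rw [smul_eq_C_mul, mul_left_comm]
        exact Ideal.mul_mem_left _ _ he }
  have hmemN : ∀ b, b ∈ N ↔ ∃ e : ℕ, C Polynomial.X ^ e * b ∈ J := fun _ => Iff.rfl
  have hloc : ∀ x ∈ pts, ∃ h : MvPolynomial (Fin n) k, eval x h ≠ 0 ∧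
      ∀ b ∈ N, ∃ a, constFam n k h ^ a * b ∈ J := by
    intro x hx
    obtain ⟨-, h, hxh, hh⟩ := hpts x hx
    refine ⟨h, hxh, fun b hb => ?_⟩
    obtain ⟨e, he⟩ := (hmemN b).1 hb
    clear hb
    induction e generalizing b with
    | zero => exact ⟨0, by simpa using he⟩
    | succ e ih =>
      rw [pow_succ, mul_assoc] at he
      obtain ⟨a, ha⟩ := ih _ he
      rw [mul_left_comm] at ha
      obtain ⟨a', ha'⟩ := exists_pow_mul_mem_of_isolated hp hq hn F g (hI ▸ hh) ha
      refine ⟨a' + a, ?_⟩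
      rwa [pow_add, mul_assoc]
  refine forall_eq_zero_of_eval_eq_zero N 0 ?_ _ ?_ u ((hmemN _).2 ⟨0, by simpa using hu⟩)
  · intro b hb
    obtain ⟨e, he⟩ := (hmemN _).1 hb
    refine (hmemN _).2 ⟨e + 1, ?_⟩
    rw [map_zero, sub_zero, smul_eq_C_mul] at he
    rwa [pow_succ, mul_assoc]
  · intro u hu
    refine congrFun (hv (fun j => (u j).eval 0) fun x => ?_)
    obtain ⟨h, hxh, hh⟩ := hloc x x.2
    obtain ⟨a, ha⟩ := hh _ hu
    have h1 := Ideal.mem_map_of_mem (spec n 0) ha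
    rw [hI, map_mul, map_pow, spec_constFam, map_sum] at h1
    simp only [spec_smul, spec_constFam] at h1
    refine mem_of_mul_mem_of_boxIdeal_le (le_sup_right (a := I)) (h := h ^ a) ?_
      (Ideal.mem_sup_left h1)
    rw [map_pow]
    exact pow_ne_zero _ hxh

/-- The Bézout-type bound for determinantal systems with prescribed row degrees. -/
theorem sum_multAt_le (hp : 1 ≤ p) (hq : q + 1 = m + p) (hn : n = m + s)
    (F : Matrix (Fin p) (Fin q) (MvPolynomial (Fin n) k)) (g : Fin s → MvPolynomial (Fin n) k)
    {α : Fin p → ℕ} {β : Fin s → ℕ} (hα : ∀ i j, (F i j).totalDegree ≤ α i)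
    (hβ : ∀ i, (g i).totalDegree ≤ β i) (pts : Finset (Fin n → k))
    (hpts : ∀ x ∈ pts, IsIsolatedZero (minorIdeal F ⊔ Ideal.span (Set.range g)) x) :
    ∑ x ∈ pts, multAt (minorIdeal F ⊔ Ideal.span (Set.range g)) x ≤
      (∏ i, β i) * hsym m univ α := by
  obtain ⟨H, h, hH, hh, hB⟩ := exists_model (k := k) hq hn α β
  set I := minorIdeal F ⊔ Ideal.span (Set.range g) with hI
  let Ft : Matrix (Fin p) (Fin q) (MvPolynomial (Fin n) (Polynomial k)) :=
    Matrix.of fun i j => pencil (F i j) (H i j)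
  let gt : Fin s → MvPolynomial (Fin n) (Polynomial k) := fun i => pencil (g i) (h i)
  have h0 : (minorIdeal Ft ⊔ Ideal.span (Set.range gt)).map (spec n 0) = I := by
    rw [Ideal.map_sup, minorIdeal_map, Ideal.map_span, ← Set.range_comp]
    have h1 : Ft.map (spec n 0) = F := by
      ext1 i j
      exact spec_zero_pencil _ _
    have h2 : spec n 0 ∘ gt = g := funext fun i => spec_zero_pencil _ _
    rw [h1, h2]
  have hloc : ∀ x : pts, ∃ M, multAt I (x : Fin n → k) ≤
      Module.finrank k (MvPolynomial (Fin n) k ⧸ I ⊔ boxIdeal (x : Fin n → k) M) := by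
    intro x
    obtain ⟨-, h, hxh, hh⟩ := hpts x x.2
    exact exists_multAt_le hxh (mul_X_sub_C_mem_radical hh)
  choose M hM using hloc
  have hfin : ∀ x : pts, Module.Finite k
      (MvPolynomial (Fin n) k ⧸ I ⊔ boxIdeal (x : Fin n → k) (M x)) := by
    intro x
    obtain ⟨B, hB⟩ := codimLE_boxIdeal (x : Fin n → k) (M x)
    exact (hB.mono (le_sup_right (a := I))).finite
  have hcop : Pairwise (Function.onFun IsCoprime
      fun x : pts => I ⊔ boxIdeal (x : Fin n → k) (M x)) := by
    intro x y hxy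
    have h1 := isCoprime_boxIdeal (fun h => hxy (Subtype.ext h)) (M x) (M y)
    rw [Ideal.isCoprime_iff_sup_eq] at h1
    change IsCoprime (I ⊔ boxIdeal (x : Fin n → k) (M x)) (I ⊔ boxIdeal (y : Fin n → k) (M y))
    rw [Ideal.isCoprime_iff_sup_eq, eq_top_iff, ← h1]
    exact sup_le_sup le_sup_right le_sup_right
  obtain ⟨v, hv⟩ := exists_independent_mod_iInf (k := k) hcop
  have hG : ∀ x ∈ {d | ∃ c : Fin p ↪ Fin q, d = (H.submatrix id c).det} ∪ Set.range h,
      ∃ a, x.IsHomogeneous a ∧ ∃ x' ∈ minorIdeal Ft ⊔ Ideal.span (Set.range gt),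
        x'.totalDegree ≤ a ∧ spec n 1 x' = x := by
    rintro x (⟨c, rfl⟩ | ⟨i, rfl⟩)
    · refine ⟨_, isHomogeneous_det fun i j => hH i (c j), (Ft.submatrix id c).det,
        Ideal.mem_sup_left (Ideal.subset_span ⟨c, rfl⟩),
        totalDegree_det_le fun i j => totalDegree_pencil_le (hα i (c j)) (hH i (c j)).totalDegree_le,
        ?_⟩
      rw [RingHom.map_det]
      congr 1
      ext1 i j
      exact spec_one_pencil _ _
    · exact ⟨_, hh i, gt i, Ideal.mem_sup_right (Ideal.subset_span ⟨i, rfl⟩),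
        totalDegree_pencil_le (hβ i) (hh i).totalDegree_le, spec_one_pencil _ _⟩
  have hB' : CodimLE k (Ideal.span
      ({d | ∃ c : Fin p ↪ Fin q, d = (H.submatrix id c).det} ∪ Set.range h))
      ((∏ i, β i) * hsym m univ α) := by
    rw [Ideal.span_union]
    exact hB
  refine le_trans ?_ (le_of_independent_mod hG hB' v
    (independent_of_special_fibre hp hq hn Ft gt h0 hpts M v hv))
  rw [← Finset.sum_coe_sort]
  exact sum_le_sum fun x _ => hM x

end Main

end DetBezout

/-- Row-degree bound: for `F ∈ K[X₁,…,Xₙ]^{p×q}` (`p ≤ q`), `G = (g₁,…,g_s)`,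
and `n = q - p + s + 1`, the sum of the multiplicities of the isolated points of
`V(I_p(F) + ⟨g₁,…,g_s⟩)` (over the algebraic closure) is at most
`deg g₁ ⋯ deg g_s · S_{n-s}(rdeg(F,1),…,rdeg(F,p))`, where `rdeg(F,i)` is the
maximum degree in row `i` and `S_k` is the complete homogeneous symmetric polynomial. -/
theorem stmt15 (K : Type*) [Field K] [CharZero K]
    (p q s n : ℕ) (hpq : p ≤ q) (hn : n = q - p + s + 1)
    (F : Matrix (Fin p) (Fin q) (MvPolynomial (Fin n) K))
    (g : Fin s → MvPolynomial (Fin n) K) :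
    ∀ pts : Finset (Fin n → AlgebraicClosure K),
      (∀ x ∈ pts, IsIsolatedZero (detIdeal F g) x) →
      ∑ x ∈ pts, multAt (detIdeal F g) x ≤
        (∏ i, (g i).totalDegree) *
          hsym (n - s) (Finset.univ : Finset (Fin p))
            (fun i => Finset.univ.sup fun j : Fin q => (F i j).totalDegree) := by
  intro pts hpts
  rcases Nat.eq_zero_or_pos p with rfl | hp
  · have hempty : pts = ∅ := by
      refine eq_empty_of_forall_notMem fun x hx => ?_
      have h1 := (hpts x hx).1 1 (Ideal.mem_sup_left (Ideal.subset_span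
        ⟨⟨fun i => i.elim0, fun i => i.elim0⟩, by rw [Matrix.det_isEmpty]⟩))
      simp at h1
    simp [hempty]
  · have hm : n - s = q - p + 1 := by omega
    rw [hm]
    refine DetBezout.sum_multAt_le (m := q - p + 1) hp (by omega) (by omega)
      (F.map (MvPolynomial.map (algebraMap K (AlgebraicClosure K))))
      (fun i => MvPolynomial.map (algebraMap K (AlgebraicClosure K)) (g i)) (fun i j => ?_)
      (fun i => DetBezout.totalDegree_map_le _ _) pts hpts
    exact (DetBezout.totalDegree_map_le _ _).trans
      (le_sup (f := fun j => (F i j).totalDegree) (mem_univ j))
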